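/- Given a centered 1-dimensional 2-block CSBM with parameters n, p, q, σ and k = O(log n) such that γ = (p−q)/(p+q) ≥ Ω(k√(log n/(np))), p ≥ log³n / n, and σ ≤ O(1/√(log n)), with probability at least 1 − n^{−Ω(1)}: ‖(1/η^k)Ã^k x − s‖_∞ ≤ 1/(2√n) + O( (C/(γ√(np)))^k · σ·√(log n) ), where η = (p−q)n/(2d) and C is an absolute constant. -/

import Mathlib

open MeasureTheory ProbabilityTheory Matrix

/-- Bernoulli measure on `Bool` with success probability `p`. -/
noncomputable def bern (p : ℝ) : Measure Bool :=
  ENNReal.ofReal (1 - p) • Measure.dirac false + ENNReal.ofReal p • Measure.dirac true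

/-- Edge randomness of the 2-block stochastic block model on `n` vertices:
independent Bernoulli variables, with probability `p` for pairs inside a class and `q`
across classes.  Class `S` consists of the first `n/2` vertices; only the upper triangle
is used to build the (symmetric) adjacency matrix. -/
noncomputable def sbm (n : ℕ) (p q : ℝ) : Measure (Fin n → Fin n → Bool) :=
  Measure.pi fun i => Measure.pi fun j =>
    bern (if ((i : ℕ) < n / 2 ↔ (j : ℕ) < n / 2) then p else q)

/-- The (symmetric, hollow) adjacency matrix built from the edge indicators. -/
noncomputable def adjM {n : ℕ} (ω : Fin n → Fin n → Bool) : Matrix (Fin n) (Fin n) ℝ :=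
  Matrix.of fun i j =>
    if i = j then 0 else if (if i ≤ j then ω i j else ω j i) then 1 else 0

/-- Empirical average degree `d = 2|E|/n`. -/
noncomputable def avgDeg {n : ℕ} (ω : Fin n → Fin n → Bool) : ℝ :=
  (∑ i, ∑ j, adjM ω i j) / n

/-- Corrected graph convolution matrix `Ã = (1/d)A - (1/n)𝟙𝟙ᵀ`. -/
noncomputable def tildeA {n : ℕ} (ω : Fin n → Fin n → Bool) : Matrix (Fin n) (Fin n) ℝ :=
  (avgDeg ω)⁻¹ • adjM ω - (n : ℝ)⁻¹ • Matrix.of (fun _ _ => (1 : ℝ))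

/-- The unit signal vector `s`, with entries `1/√n` on `S` and `-1/√n` on `T`. -/
noncomputable def sig (n : ℕ) : Fin n → ℝ :=
  fun i => if (i : ℕ) < n / 2 then (Real.sqrt n)⁻¹ else -(Real.sqrt n)⁻¹

/-- Spectral norm (ℓ²→ℓ² operator norm) of a real square matrix. -/
noncomputable def specNorm {n : ℕ} (M : Matrix (Fin n) (Fin n) ℝ) : ℝ :=
  ‖Matrix.toEuclideanCLM (𝕜 := ℝ) M‖

/-- Gaussian noise for the centered 1-dimensional features. -/
noncomputable def gauss1 (n : ℕ) (σ : ℝ) : Measure (Fin n → ℝ) :=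
  Measure.pi fun _ : Fin n => gaussianReal 0 (Real.toNNReal (σ ^ 2))

/-- The unordered pair `{a, b}`, encoded as the sorted pair. -/
def edgeKey {α : Type*} [LinearOrder α] (a b : α) : α × α := (min a b, max a b)

lemma edgeKey_eq_iff {α : Type*} [LinearOrder α] {a b c d : α} :
    edgeKey a b = edgeKey c d ↔ (a = c ∧ b = d) ∨ (a = d ∧ b = c) := by
  simp only [edgeKey, Prod.mk.injEq]
  constructor
  · rintro ⟨h1, h2⟩
    rcases le_total a b with h | h <;> rcases le_total c d with h' | h' <;>
      simp_all
  · rintro (⟨rfl, rfl⟩ | ⟨rfl, rfl⟩)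
    · simp
    · simp [min_comm, max_comm]

/-- Every value taken by `f` is taken at least twice. -/
def NoSingleton {ι κ : Type*} (f : ι → κ) : Prop := ∀ t, ∃ u, u ≠ t ∧ f u = f t

lemma NoSingleton.two_mul_card_image_le {ι κ : Type*} [Fintype ι] [DecidableEq κ] {f : ι → κ}
    (h : NoSingleton f) : 2 * (Finset.univ.image f).card ≤ Fintype.card ι := by
  rw [← Finset.card_univ,
    Finset.card_eq_sum_card_image f Finset.univ, mul_comm, ← smul_eq_mul]
  refine Finset.card_nsmul_le_sum _ _ _ fun x hx => ?_
  obtain ⟨t, -, rfl⟩ := Finset.mem_image.1 hx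
  obtain ⟨u, hu, hut⟩ := h t
  exact Finset.one_lt_card.2 ⟨u, by simp [hut], t, by simp, hu⟩

/-- In a connected exploration from the root `i`, the number of discovered vertices is at most the
number of distinct edges used. -/
lemma card_discovered_le_card_edges {ι V : Type*} [Fintype ι] [LinearOrder V] (i : V)
    (a b : ι → V) (rank : ι → ℕ)
    (h : ∀ t, a t = i ∨ ∃ s, rank s < rank t ∧ b s = a t) :
    ((Finset.univ.image b).erase i).card ≤
      (Finset.univ.image fun t => edgeKey (a t) (b t)).card := by
  have hmin : ∀ x ∈ (Finset.univ.image b).erase i, ∃ t, b t = x ∧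
      ∀ s, b s = x → rank t ≤ rank s := by
    intro x hx
    obtain ⟨t0, -, ht0⟩ := Finset.mem_image.1 (Finset.mem_of_mem_erase hx)
    obtain ⟨t, ht, hm⟩ := Finset.exists_min_image (Finset.univ.filter fun t => b t = x) rank
      ⟨t0, by simp [ht0]⟩
    exact ⟨t, by simpa using ht, fun s hs => hm s (by simp [hs])⟩
  rcases isEmpty_or_nonempty ι with hι | hι
  · simp
  choose! τ hτ hτm using hmin
  refine Finset.card_le_card_of_injOn (fun x => edgeKey (a (τ x)) (b (τ x)))
    (fun x _ => Finset.mem_coe.2 (Finset.mem_image_of_mem _ (Finset.mem_univ _))) ?_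
  intro x hx y hy hxy
  rcases edgeKey_eq_iff.1 hxy with ⟨-, h2⟩ | ⟨h1, h2⟩
  · rw [← hτ x hx, ← hτ y hy, h2]
  · exfalso
    have aux : ∀ x ∈ (Finset.univ.image b).erase i, ∀ y ∈ (Finset.univ.image b).erase i,
        a (τ x) = b (τ y) → rank (τ y) < rank (τ x) := by
      intro x hx y hy hxy
      rw [hτ y hy] at hxy
      rcases h (τ x) with h' | ⟨s, hs, hs'⟩
      · exact absurd (hxy.symm.trans h') (Finset.ne_of_mem_erase hy)
      · exact (hτm y hy s (hs'.trans hxy)).trans_lt hs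
    exact lt_asymm (aux x hx y hy h1) (aux y hy x hx h2.symm)

/-- Sum over all words of `x ^ (number of letters different from i)`. -/
lemma sum_pow_card_image_le {V : Type*} [Fintype V] [DecidableEq V] (i : V) {x : ℝ}
    (hx : 0 ≤ x) (M : ℕ) : ∀ N : ℕ, N ≤ M →
    ∑ b : Fin N → V, x ^ ((Finset.univ.image b).erase i).card ≤
      (M + 1 + Fintype.card V * x) ^ N
  | 0, _ => by simp
  | N + 1, hN => by
    rw [← (Fin.consEquiv fun _ => V).sum_comp, Fintype.sum_prod_type_right, pow_succ]
    refine le_trans ?_ (mul_le_mul_of_nonneg_right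
      (sum_pow_card_image_le i hx M N (by omega)) (by positivity))
    rw [Finset.sum_mul]
    refine Finset.sum_le_sum fun b _ => ?_
    have himg : ∀ c, Finset.univ.image (Fin.consEquiv (fun _ => V) (c, b)) =
        insert c (Finset.univ.image b) := by
      intro c
      ext y
      simp [Fin.consEquiv, Fin.exists_fin_succ, eq_comm]
    set S := Finset.univ.image b with hS
    have hterm : ∀ c, x ^ ((Finset.univ.image (Fin.consEquiv (fun _ => V) (c, b))).erase i).card ≤
        x ^ (S.erase i).card * ((if c ∈ insert i S then 1 else 0) + x) := by
      intro c
      rw [himg]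
      split_ifs with hc
      · have : (insert c S).erase i = S.erase i := by
          rcases Finset.mem_insert.1 hc with rfl | hc
          · simp
          · rw [Finset.insert_eq_of_mem hc]
        rw [this]
        nlinarith [pow_nonneg hx (S.erase i).card, mul_nonneg (pow_nonneg hx (S.erase i).card) hx]
      · have hci : c ≠ i := by rintro rfl; simp at hc
        have hcS : c ∉ S := fun h => hc (Finset.mem_insert_of_mem h)
        rw [Finset.erase_insert_of_ne hci, Finset.card_insert_of_notMem (by simp [hcS]), pow_succ,
          zero_add]
    refine (Finset.sum_le_sum fun c _ => hterm c).trans ?_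
    rw [← Finset.mul_sum]
    refine mul_le_mul_of_nonneg_left ?_ (by positivity)
    rw [Finset.sum_add_distrib, Finset.sum_ite_mem]
    have h1 : (insert i S).card ≤ M + 1 := by
      refine (Finset.card_insert_le _ _).trans ?_
      have : S.card ≤ N := by simpa using Finset.card_image_le (s := Finset.univ) (f := b)
      omega
    have h1' : ((insert i S).card : ℝ) ≤ M + 1 := by exact_mod_cast h1
    simpa using h1'

/-- Words with few distinct letters have small total weight. -/
lemma sum_sparse_words_le {ι V : Type*} [Fintype ι] [DecidableEq ι] [Fintype V] [DecidableEq V]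
    (i : V) {p : ℝ}
    (hp : 0 < p) (H : ℕ) (hι : Fintype.card ι = 2 * H)
    (hnp : 2 * (H : ℝ) + 1 ≤ Fintype.card V * p) :
    ∑ b : ι → V, (if ((Finset.univ.image b).erase i).card ≤ H then
        p ^ ((Finset.univ.image b).erase i).card else 0) ≤
      (4 * (Fintype.card V * p) * (2 * H + 1)) ^ H := by
  set n : ℝ := (Fintype.card V : ℝ)
  set L : ℝ := 2 * H + 1 with hL
  have hLpos : 0 < L := by positivity
  have hn : 0 < n := by
    by_contra h
    have : n = 0 := le_antisymm (not_lt.1 h) (Nat.cast_nonneg _)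
    rw [this] at hnp; linarith
  have hnp' : 0 < n * p := by positivity
  have key : ∀ v : ℕ, (if v ≤ H then p ^ v else 0) ≤ (n * p / L) ^ H * (L / n) ^ v := by
    intro v
    split_ifs with hv
    · have h1 : (1 : ℝ) ≤ n * p / L := by rw [le_div_iff₀ hLpos]; linarith
      calc p ^ v = (n * p / L) ^ v * (L / n) ^ v := by
            rw [← mul_pow, show n * p / L * (L / n) = p by field_simp]
        _ ≤ _ := by gcongr
    · positivity
  have e := Fintype.equivFinOfCardEq hι
  calc _ ≤ ∑ b : ι → V, (n * p / L) ^ H * (L / n) ^ ((Finset.univ.image b).erase i).card :=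
        Finset.sum_le_sum fun b _ => key _
    _ = (n * p / L) ^ H *
        ∑ b : Fin (2 * H) → V, (L / n) ^ ((Finset.univ.image b).erase i).card := by
      rw [← Finset.mul_sum, ← (e.arrowCongr (Equiv.refl V)).sum_comp]
      congr 1
      refine Finset.sum_congr rfl fun b _ => ?_
      have : Finset.univ.image ((e.arrowCongr (Equiv.refl V)) b) = Finset.univ.image b := by
        ext y
        simp [Equiv.arrowCongr, e.symm.surjective.exists]
      rw [this]
    _ ≤ (n * p / L) ^ H * ((2 * H : ℕ) + 1 + n * (L / n)) ^ (2 * H) := by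
      gcongr
      exact sum_pow_card_image_le i (by positivity) _ _ le_rfl
    _ = _ := by
      rw [pow_mul, ← mul_pow]
      congr 1
      push_cast
      field_simp
      rw [← hL]; ring

lemma exists_fiber_card_eq_one {ι κ : Type*} [Fintype ι] [DecidableEq κ] {f : ι → κ}
    (h : ¬ NoSingleton f) : ∃ x, (Finset.univ.filter fun t => f t = x).card = 1 := by
  simp only [NoSingleton, not_forall, not_exists, not_and] at h
  obtain ⟨t, ht⟩ := h
  refine ⟨f t, Finset.card_eq_one.2 ⟨t, ?_⟩⟩
  ext u
  simp only [Finset.mem_filter, Finset.mem_univ, true_and, Finset.mem_singleton]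
  exact ⟨fun h => by_contra fun hu => ht u hu h, fun h => h ▸ rfl⟩

lemma NoSingleton.two_le_fiber_card {ι κ : Type*} [Fintype ι] [DecidableEq κ] {f : ι → κ}
    (h : NoSingleton f) {x : κ} (hx : x ∈ Finset.univ.image f) :
    2 ≤ (Finset.univ.filter fun t => f t = x).card := by
  obtain ⟨t, -, rfl⟩ := Finset.mem_image.1 hx
  obtain ⟨u, hu, hut⟩ := h t
  exact Finset.one_lt_card.2 ⟨u, by simp [hut], t, by simp, hu⟩

lemma fiber_card_eq_zero {ι κ : Type*} [Fintype ι] [DecidableEq κ] {f : ι → κ}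
    {x : κ} (hx : x ∉ Finset.univ.image f) :
    (Finset.univ.filter fun t => f t = x).card = 0 := by
  rw [Finset.card_eq_zero, Finset.filter_eq_empty_iff]
  exact fun t _ ht => hx (Finset.mem_image.2 ⟨t, Finset.mem_univ _, ht⟩)

open Classical in
/-- A product of moments of sparse centred variables. -/
lemma abs_prod_moments_le {ι κ : Type*} [Fintype ι] [Fintype κ] (f : ι → κ)
    (m : κ → ℕ → ℝ) (p : ℝ) (h0 : ∀ x, m x 0 = 1) (h1 : ∀ x, m x 1 = 0)
    (h2 : ∀ x j, 2 ≤ j → |m x j| ≤ p) :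
    |∏ x, m x (Finset.univ.filter fun t => f t = x).card| ≤
      if NoSingleton f then p ^ (Finset.univ.image f).card else 0 := by
  split_ifs with h
  · rw [← Finset.prod_subset (Finset.subset_univ (Finset.univ.image f))
      (fun x _ hx => by rw [fiber_card_eq_zero hx, h0]), Finset.abs_prod]
    refine (Finset.prod_le_prod (fun _ _ => abs_nonneg _) fun x hx =>
      h2 x _ (h.two_le_fiber_card hx)).trans ?_
    simp
  · obtain ⟨x, hx⟩ := exists_fiber_card_eq_one h
    rw [Finset.prod_eq_zero (Finset.mem_univ x) (by rw [hx, h1])]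
    simp

open Classical in
lemma le_prod_moments {ι κ : Type*} [Fintype ι] [Fintype κ] (f : ι → κ)
    (m : ℕ → ℝ) (h0 : m 0 = 1) (h1 : m 1 = 0) (h2 : ∀ j, 2 ≤ j → 1 ≤ m j) :
    (if NoSingleton f then 1 else 0) ≤
      ∏ x, m (Finset.univ.filter fun t => f t = x).card := by
  split_ifs with h
  · rw [← Finset.prod_const_one (s := (Finset.univ : Finset κ))]
    refine Finset.prod_le_prod (fun _ _ => zero_le_one) fun x _ => ?_
    by_cases hx : x ∈ Finset.univ.image f
    · exact h2 _ (h.two_le_fiber_card hx)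
    · rw [fiber_card_eq_zero hx, h0]
  · obtain ⟨x, hx⟩ := exists_fiber_card_eq_one h
    rw [Finset.prod_eq_zero (Finset.mem_univ x) (by rw [hx, h1])]

/-- The sequence of edges traversed by a walk. -/
def walkKey {V : Type*} [LinearOrder V] {L : ℕ} (w : Fin (L + 1) → V) (t : Fin L) : V × V :=
  edgeKey (w t.castSucc) (w t.succ)

lemma pow_mulVec_eq_sum_walks {V : Type*} [Fintype V] [DecidableEq V] (M : Matrix V V ℝ)
    (f : V → ℝ) : ∀ (L : ℕ) (i : V), (M ^ L).mulVec f i =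
      ∑ b : Fin L → V, (∏ t, M ((Fin.cons i b : Fin (L + 1) → V) t.castSucc) (b t)) *
        f ((Fin.cons i b : Fin (L + 1) → V) (Fin.last L))
  | 0, i => by simp
  | L + 1, i => by
    rw [← (Fin.consEquiv fun _ => V).sum_comp, Fintype.sum_prod_type, pow_succ',
      ← Matrix.mulVec_mulVec, Matrix.mulVec, dotProduct]
    refine Finset.sum_congr rfl fun x _ => ?_
    rw [pow_mulVec_eq_sum_walks M f L x, Finset.mul_sum]
    refine Finset.sum_congr rfl fun b _ => ?_
    rw [Fin.prod_univ_succ]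
    simp only [Fin.consEquiv, Equiv.coe_fn_mk, Fin.castSucc_zero, Fin.cons_zero,
      ← Fin.succ_castSucc, Fin.cons_succ, ← Fin.succ_last]
    ring

/-- A walk pattern in which every edge is traversed at least twice. -/
def RepeatedPattern {L : ℕ} (s : Setoid (Fin (L + 1))) : Prop :=
  ∀ t : Fin L, ∃ u, u ≠ t ∧ ((s u.castSucc t.castSucc ∧ s u.succ t.succ) ∨
    (s u.castSucc t.succ ∧ s u.succ t.castSucc))

lemma noSingleton_walkKey_iff {V : Type*} [LinearOrder V] {L : ℕ} (w : Fin (L + 1) → V) :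
    NoSingleton (walkKey w) ↔ RepeatedPattern (Setoid.ker w) := by
  simp only [NoSingleton, RepeatedPattern, walkKey, edgeKey_eq_iff, Setoid.ker_def]

instance finite_setoid {α : Type*} [Finite α] : Finite (Setoid α) :=
  Finite.of_injective (fun s : Setoid α => fun a b => s a b) fun s t h =>
    Setoid.ext fun a b => by simpa using congrFun (congrFun h a) b

open Classical in
noncomputable instance fintype_setoid {α : Type*} [Finite α] : Fintype (Setoid α) :=
  Fintype.ofFinite _

/-- Functions with a given kernel are the injections of the quotient. -/
def kerFiberEquiv {α A : Type*} (s : Setoid α) :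
    {w : α → A // Setoid.ker w = s} ≃ (Quotient s ↪ A) where
  toFun w := ⟨Quotient.lift w.1 fun a b h => by
      have h' : s a b := h
      rwa [← w.2, Setoid.ker_def] at h', by
    rintro ⟨a⟩ ⟨b⟩ h
    refine Quotient.sound (s := s) ?_
    have h' : w.1 a = w.1 b := h
    rw [← Setoid.ker_def, w.2] at h'
    exact h'⟩
  invFun e := ⟨fun a => e (Quotient.mk s a), by
    ext a b
    rw [Setoid.ker_def, e.injective.eq_iff, Quotient.eq]⟩
  left_inv w := by ext a; rfl
  right_inv e := by
    ext x
    induction x using Quotient.inductionOn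
    rfl

lemma sum_ker_eq {α A : Type*} [Fintype α] [DecidableEq α] [Fintype A] (F : Setoid α → ℝ) :
    ∑ w : α → A, F (Setoid.ker w) =
      ∑ s : Setoid α, ((Fintype.card A).descFactorial (Nat.card (Quotient s)) : ℝ) * F s := by
  classical
  rw [← Finset.sum_fiberwise Finset.univ (fun w : α → A => Setoid.ker w)]
  refine Finset.sum_congr rfl fun s _ => ?_
  rw [Finset.sum_congr rfl (g := fun _ => F s)
    (fun w hw => by rw [(Finset.mem_filter.1 hw).2]), Finset.sum_const, nsmul_eq_mul]
  congr 2
  rw [← Fintype.card_subtype, Fintype.card_congr (kerFiberEquiv s), Fintype.card_embedding_eq,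
    Nat.card_eq_fintype_card]

lemma card_quotient_ker {α A : Type*} [Fintype α] [DecidableEq A] (w : α → A) :
    Nat.card (Quotient (Setoid.ker w)) = (Finset.univ.image w).card := by
  rw [Nat.card_congr (Setoid.quotientKerEquivRange w), Nat.card_coe_set_eq,
    Set.ncard_eq_toFinset_card', Set.toFinset_range]

lemma descFactorial_mul_le {n r m v : ℕ} {p : ℝ} (hp : 0 ≤ p) (hv : v ≤ m)
    (h : n * p + m ≤ r) :
    (n.descFactorial (v + 1) : ℝ) * p ^ v * r ≤ n * r.descFactorial (v + 1) := by
  have h1 : ∀ k ≤ v, (n.descFactorial (k + 1) : ℝ) * p ^ k * r ≤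
      n * r.descFactorial (k + 1) := by
    intro k
    induction k with
    | zero => intro _; simp
    | succ k ih =>
      intro hk
      rw [Nat.descFactorial_succ n (k + 1), Nat.descFactorial_succ r (k + 1), pow_succ]
      push_cast
      have h2 : ((n - (k + 1) : ℕ) : ℝ) * p ≤ ((r - (k + 1) : ℕ) : ℝ) := by
        have h3 : ((n - (k + 1) : ℕ) : ℝ) ≤ n := by exact_mod_cast Nat.sub_le _ _
        have h4 : (k + 1 : ℝ) ≤ m := by exact_mod_cast hk.trans hv
        have h5 : k + 1 ≤ r := by
          have : (m : ℝ) ≤ r := by nlinarith [mul_nonneg (Nat.cast_nonneg (α := ℝ) n) hp]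
          exact (hk.trans hv).trans (by exact_mod_cast this)
        rw [Nat.cast_sub h5]
        push_cast
        nlinarith
      calc _ = (((n - (k + 1) : ℕ) : ℝ) * p) * ((n.descFactorial (k + 1) : ℝ) * p ^ k * r) := by
            ring
        _ ≤ ((r - (k + 1) : ℕ) : ℝ) * (n * r.descFactorial (k + 1)) := by
            exact mul_le_mul h2 (ih (by omega)) (by positivity) (by positivity)
        _ = _ := by ring
  exact h1 v le_rfl

lemma card_image_le_card_image_walkKey {V : Type*} [LinearOrder V] {L : ℕ} (w : Fin (L + 1) → V) :
    (Finset.univ.image w).card ≤ (Finset.univ.image (walkKey w)).card + 1 := by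
  have h1 := card_discovered_le_card_edges (w 0) (fun t : Fin L => w t.castSucc)
    (fun t => w t.succ) (fun t => t) (by
      intro t
      rcases Nat.eq_zero_or_pos (t : ℕ) with h0 | h0
      · left; congr 1; ext; simpa using h0
      · right
        refine ⟨⟨t - 1, by omega⟩, by simp; omega, ?_⟩
        congr 1; ext; simp; omega)
  have h2 : Finset.univ.image w ⊆
      insert (w 0) ((Finset.univ.image fun t : Fin L => w t.succ).erase (w 0)) := by
    intro x hx
    obtain ⟨t, -, rfl⟩ := Finset.mem_image.1 hx
    by_cases hx0 : w t = w 0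
    · simp [hx0]
    · refine Finset.mem_insert_of_mem (Finset.mem_erase.2 ⟨hx0, ?_⟩)
      obtain ⟨u, rfl⟩ := Fin.exists_succ_eq.2 (fun h : t = 0 => hx0 (by rw [h]))
      exact Finset.mem_image_of_mem (fun t : Fin L => w t.succ) (Finset.mem_univ u)
  exact (Finset.card_le_card h2).trans ((Finset.card_insert_le _ _).trans
    (Nat.add_le_add_right h1 1))

open Classical in
/-- Dimension reduction: sparse walks on `n` vertices are controlled by walks on `r` vertices. -/
lemma sum_sparse_walks_le {n r m : ℕ} {p : ℝ} (hp : 0 ≤ p) (hp1 : p ≤ 1) (hr : 0 < r)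
    (h : n * p + m ≤ r) :
    ∑ w : Fin (2 * m + 1) → Fin n, (if NoSingleton (walkKey w) then
        p ^ (Finset.univ.image (walkKey w)).card else 0) ≤
      (n : ℝ) / r * ∑ w : Fin (2 * m + 1) → Fin r, (if NoSingleton (walkKey w) then 1 else 0) := by
  let F : Setoid (Fin (2 * m + 1)) → ℝ := fun s =>
    if RepeatedPattern s ∧ Nat.card (Quotient s) ≤ m + 1 then p ^ (Nat.card (Quotient s) - 1) else 0
  let G : Setoid (Fin (2 * m + 1)) → ℝ := fun s => if RepeatedPattern s then 1 else 0
  calc _ ≤ ∑ w : Fin (2 * m + 1) → Fin n, F (Setoid.ker w) := by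
        refine Finset.sum_le_sum fun w _ => ?_
        by_cases hw : NoSingleton (walkKey w)
        · have h1 := card_image_le_card_image_walkKey w
          have h2 := hw.two_mul_card_image_le
          rw [Fintype.card_fin] at h2
          simp only [F]
          rw [if_pos hw, card_quotient_ker, if_pos ⟨(noSingleton_walkKey_iff w).1 hw, by omega⟩]
          exact pow_le_pow_of_le_one hp hp1 (by omega)
        · rw [if_neg hw]
          simp only [F]
          split_ifs <;> positivity
    _ = ∑ s, ((Fintype.card (Fin n)).descFactorial (Nat.card (Quotient s)) : ℝ) * F s :=
        sum_ker_eq F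
    _ ≤ ∑ s, (n : ℝ) / r *
        (((Fintype.card (Fin r)).descFactorial (Nat.card (Quotient s)) : ℝ) * G s) := by
        refine Finset.sum_le_sum fun s _ => ?_
        simp only [F, G, Fintype.card_fin]
        by_cases hs : RepeatedPattern s ∧ Nat.card (Quotient s) ≤ m + 1
        · rw [if_pos hs, if_pos hs.1]
          have hpos : 0 < Nat.card (Quotient s) :=
            Nat.card_pos_iff.2 ⟨⟨Quotient.mk s 0⟩, inferInstance⟩
          obtain ⟨v, hv⟩ := Nat.exists_eq_succ_of_ne_zero hpos.ne'
          rw [hv, Nat.succ_eq_add_one, Nat.add_sub_cancel]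
          have := descFactorial_mul_le hp (show v ≤ m by omega) h
          have hr' : (0 : ℝ) < r := by exact_mod_cast hr
          rw [mul_one, div_mul_eq_mul_div, le_div_iff₀ hr']
          exact this
        · rw [if_neg hs, mul_zero]
          split_ifs <;> positivity
    _ = (n : ℝ) / r * ∑ w : Fin (2 * m + 1) → Fin r, G (Setoid.ker w) := by
        rw [sum_ker_eq G, Finset.mul_sum]
    _ = _ := by simp only [G, noSingleton_walkKey_iff]

lemma specNorm_nonneg {n : ℕ} (M : Matrix (Fin n) (Fin n) ℝ) : 0 ≤ specNorm M := norm_nonneg _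

lemma norm_mulVec_le {n : ℕ} (M : Matrix (Fin n) (Fin n) ℝ) (x : Fin n → ℝ) :
    ‖WithLp.toLp 2 (M.mulVec x)‖ ≤ specNorm M * ‖WithLp.toLp 2 x‖ := by
  rw [← Matrix.toEuclideanCLM_toLp (𝕜 := ℝ)]
  exact ContinuousLinearMap.le_opNorm _ _

lemma abs_dotProduct_le {n : ℕ} (x y : Fin n → ℝ) :
    |x ⬝ᵥ y| ≤ ‖WithLp.toLp 2 x‖ * ‖WithLp.toLp 2 y‖ := by
  have := abs_real_inner_le_norm (WithLp.toLp 2 y) (WithLp.toLp 2 x)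
  rw [EuclideanSpace.inner_toLp_toLp] at this
  simpa [mul_comm] using this

lemma norm_toLp_sq {n : ℕ} (x : Fin n → ℝ) : ‖WithLp.toLp 2 x‖ ^ 2 = ∑ i, x i ^ 2 := by
  rw [EuclideanSpace.norm_sq_eq]
  simp

lemma abs_dotProduct_mulVec_le {n : ℕ} (M : Matrix (Fin n) (Fin n) ℝ) (x y : Fin n → ℝ) :
    |x ⬝ᵥ M.mulVec y| ≤ specNorm M * (‖WithLp.toLp 2 x‖ * ‖WithLp.toLp 2 y‖) := by
  refine (abs_dotProduct_le _ _).trans ?_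
  calc _ ≤ ‖WithLp.toLp 2 x‖ * (specNorm M * ‖WithLp.toLp 2 y‖) := by
        gcongr; exact norm_mulVec_le M y
    _ = _ := by ring

lemma specNorm_le_of_bilinear {n : ℕ} {M : Matrix (Fin n) (Fin n) ℝ} {C : ℝ} (hC : 0 ≤ C)
    (h : ∀ x y : Fin n → ℝ, ‖WithLp.toLp 2 x‖ = 1 → ‖WithLp.toLp 2 y‖ = 1 →
      x ⬝ᵥ M.mulVec y ≤ C) : specNorm M ≤ C := by
  refine ContinuousLinearMap.opNorm_le_of_re_inner_le hC fun x y hx hy => ?_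
  have := h y.ofLp x.ofLp hy hx
  rw [real_inner_comm, Matrix.inner_toEuclideanCLM]
  exact this

lemma specNorm_pow_le {n : ℕ} (M : Matrix (Fin n) (Fin n) ℝ) {k : ℕ} (hk : 0 < k) :
    specNorm (M ^ k) ≤ specNorm M ^ k := by
  rw [specNorm, map_pow]
  exact norm_pow_le' _ hk

/-- Integer vectors of squared length at most `7r`. -/
noncomputable def latticeNet (r : ℕ) : Finset (Fin r → ℤ) :=
  (Fintype.piFinset fun _ => Finset.Icc (-(7 * r : ℤ)) (7 * r)).filter
    fun z => ∑ i, z i ^ 2 ≤ 7 * r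

lemma mem_latticeNet {r : ℕ} {z : Fin r → ℤ} : z ∈ latticeNet r ↔ ∑ i, z i ^ 2 ≤ 7 * r := by
  simp only [latticeNet, Finset.mem_filter, Fintype.mem_piFinset, Finset.mem_Icc,
    and_iff_right_iff_imp]
  intro h i
  have h1 : z i ^ 2 ≤ 7 * r :=
    (Finset.single_le_sum (fun j _ => sq_nonneg (z j)) (Finset.mem_univ i)).trans h
  constructor <;> nlinarith [sq_nonneg (z i - 1), sq_nonneg (z i + 1), Int.le_self_sq (z i),
    Int.le_self_sq (-z i)]

lemma sum_half_pow_natAbs_le (N : ℕ) :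
    ∑ t ∈ Finset.Icc (-(N : ℤ)) N, (1 / 2 : ℝ) ^ t.natAbs ≤ 4 := by
  have h : ∀ N : ℕ, ∑ t ∈ Finset.Icc (-(N : ℤ)) N, (1 / 2 : ℝ) ^ t.natAbs =
      3 - 2 * (1 / 2) ^ N := by
    intro N
    induction N with
    | zero => norm_num
    | succ N ih =>
      have : Finset.Icc (-((N + 1 : ℕ) : ℤ)) (N + 1 : ℕ) =
          insert (-((N + 1 : ℕ) : ℤ)) (insert ((N + 1 : ℕ) : ℤ) (Finset.Icc (-(N : ℤ)) N)) := by
        ext t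
        simp only [Finset.mem_Icc, Finset.mem_insert]
        push_cast
        omega
      rw [this, Finset.sum_insert, Finset.sum_insert, ih, Int.natAbs_neg, Int.natAbs_natCast]
      · ring
      · simp
      · simp only [Finset.mem_insert, Finset.mem_Icc]
        push_cast
        omega
  rw [h]
  have : (0 : ℝ) ≤ (1 / 2) ^ N := by positivity
  linarith

lemma card_latticeNet_le (r : ℕ) : ((latticeNet r).card : ℝ) ≤ 512 ^ r := by
  have h1 : ∀ z ∈ latticeNet r, (1 : ℝ) ≤ 2 ^ (7 * r) * ∏ i, (1 / 2 : ℝ) ^ (z i).natAbs := by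
    intro z hz
    have h2 : ∑ i, (z i).natAbs ≤ 7 * r := by
      have h3 := mem_latticeNet.1 hz
      have h4 : ∑ i, ((z i).natAbs : ℤ) ≤ 7 * r :=
        (Finset.sum_le_sum fun i _ => by
          rw [← Int.natAbs_sq, sq]
          exact_mod_cast Nat.le_mul_self _).trans h3
      exact_mod_cast h4
    rw [Finset.prod_pow_eq_pow_sum, one_div, inv_pow, ← div_eq_mul_inv, le_div_iff₀ (by positivity),
      one_mul]
    exact pow_le_pow_right₀ (by norm_num) h2
  calc ((latticeNet r).card : ℝ) = ∑ z ∈ latticeNet r, (1 : ℝ) := by simp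
    _ ≤ ∑ z ∈ latticeNet r, 2 ^ (7 * r) * ∏ i, (1 / 2 : ℝ) ^ (z i).natAbs :=
        Finset.sum_le_sum h1
    _ ≤ ∑ z ∈ Fintype.piFinset fun _ : Fin r => Finset.Icc (-(7 * r : ℤ)) (7 * r),
        2 ^ (7 * r) * ∏ i, (1 / 2 : ℝ) ^ (z i).natAbs :=
        Finset.sum_le_sum_of_subset_of_nonneg (Finset.filter_subset _ _)
          fun z _ _ => by positivity
    _ = 2 ^ (7 * r) * ∏ i : Fin r, ∑ t ∈ Finset.Icc (-(7 * r : ℤ)) (7 * r),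
        (1 / 2 : ℝ) ^ t.natAbs := by
        rw [← Finset.mul_sum, Finset.prod_univ_sum]
    _ ≤ 2 ^ (7 * r) * ∏ i : Fin r, 4 := by
        gcongr
        exact_mod_cast sum_half_pow_natAbs_le (7 * r)
    _ = 512 ^ r := by
        rw [Finset.prod_const, Finset.card_univ, Fintype.card_fin, pow_mul, ← mul_pow]
        norm_num

lemma exists_latticeNet_near {r : ℕ} (hr : 0 < r) {x : Fin r → ℝ} (hx : ‖WithLp.toLp 2 x‖ = 1) :
    ∃ z ∈ latticeNet r, ‖WithLp.toLp 2 (x - fun i => (z i : ℝ) / (2 * √r))‖ ≤ 1 / 4 ∧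
      ‖WithLp.toLp 2 (fun i => (z i : ℝ) / (2 * √r))‖ ≤ 5 / 4 := by
  have hr' : (0 : ℝ) < √r := Real.sqrt_pos.2 (by exact_mod_cast hr)
  have hrr : √(r : ℝ) ^ 2 = r := Real.sq_sqrt (Nat.cast_nonneg _)
  set z : Fin r → ℤ := fun i => round (2 * √r * x i) with hz
  set y : Fin r → ℝ := fun i => (z i : ℝ) / (2 * √r) with hy
  have h1 : ‖WithLp.toLp 2 (x - y)‖ ≤ 1 / 4 := by
    refine abs_le_of_sq_le_sq' ?_ (by norm_num) |>.2
    rw [norm_toLp_sq]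
    have : ∀ i, (x - y) i ^ 2 ≤ 1 / (16 * r) := by
      intro i
      have h2 := abs_sub_round (2 * √r * x i)
      have h3 : (x - y) i = (2 * √r * x i - z i) / (2 * √r) := by
        simp only [Pi.sub_apply, hy]; field_simp
      rw [h3, div_pow, ← sq_abs, mul_pow, hrr, div_le_div_iff₀ (by positivity) (by positivity)]
      have : |2 * √r * x i - z i| ^ 2 ≤ (1 / 2) ^ 2 := by gcongr
      have hr0 : (0 : ℝ) < r := by exact_mod_cast hr
      nlinarith
    refine (Finset.sum_le_sum fun i _ => this i).trans ?_
    rw [Finset.sum_const, Finset.card_univ, Fintype.card_fin, nsmul_eq_mul]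
    have hr0 : (0 : ℝ) < r := by exact_mod_cast hr
    apply le_of_eq
    field_simp
    norm_num
  have h2 : ‖WithLp.toLp 2 y‖ ≤ 5 / 4 := by
    have : WithLp.toLp 2 y = WithLp.toLp 2 x - WithLp.toLp 2 (x - y) := by
      rw [← WithLp.toLp_sub]; simp
    rw [this]
    refine (norm_sub_le _ _).trans ?_
    rw [hx]; linarith
  refine ⟨z, mem_latticeNet.2 ?_, h1, h2⟩
  have h3 : ‖WithLp.toLp 2 y‖ ^ 2 ≤ (5 / 4) ^ 2 := by gcongr
  rw [norm_toLp_sq] at h3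
  have h4 : ∑ i, y i ^ 2 = (∑ i, (z i : ℝ) ^ 2) / (4 * r) := by
    rw [Finset.sum_div]
    refine Finset.sum_congr rfl fun i _ => ?_
    simp only [hy]
    rw [div_pow, mul_pow, hrr]; norm_num
  have hr0 : (0 : ℝ) < r := by exact_mod_cast hr
  rw [h4, div_le_iff₀ (by positivity)] at h3
  have : (∑ i, (z i : ℝ) ^ 2) ≤ 7 * r := by linarith
  exact_mod_cast this

lemma specNorm_le_of_latticeNet {r : ℕ} (hr : 0 < r) {M : Matrix (Fin r) (Fin r) ℝ} {D : ℝ}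
    (hD : 0 ≤ D) (h : ∀ z ∈ latticeNet r, ∀ z' ∈ latticeNet r,
      |(fun i => (z i : ℝ)) ⬝ᵥ M.mulVec fun i => (z' i : ℝ)| ≤ D) :
    specNorm M ≤ D / r := by
  have hr0 : (0 : ℝ) < r := by exact_mod_cast hr
  have hr' : (0 : ℝ) < √r := Real.sqrt_pos.2 hr0
  have hM := specNorm_nonneg M
  have key : specNorm M ≤ D / (4 * r) + 9 / 16 * specNorm M := by
    refine specNorm_le_of_bilinear (by positivity) fun x y hx hy => ?_
    obtain ⟨z, hz, hz1, hz2⟩ := exists_latticeNet_near hr hx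
    obtain ⟨z', hz', hz1', hz2'⟩ := exists_latticeNet_near hr hy
    set u : Fin r → ℝ := fun i => (z i : ℝ) / (2 * √r) with hu
    set v : Fin r → ℝ := fun i => (z' i : ℝ) / (2 * √r) with hv
    have e : x ⬝ᵥ M.mulVec y =
        u ⬝ᵥ M.mulVec v + (x - u) ⬝ᵥ M.mulVec y + u ⬝ᵥ M.mulVec (y - v) := by
      rw [Matrix.mulVec_sub, sub_dotProduct, dotProduct_sub]; ring
    have h1 : u ⬝ᵥ M.mulVec v ≤ D / (4 * r) := by
      have hu' : u = (2 * √r)⁻¹ • fun i => (z i : ℝ) := by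
        ext i; simp [hu, div_eq_inv_mul]
      have hv' : v = (2 * √r)⁻¹ • fun i => (z' i : ℝ) := by
        ext i; simp [hv, div_eq_inv_mul]
      rw [hu', hv', Matrix.mulVec_smul, smul_dotProduct, dotProduct_smul, smul_smul, smul_eq_mul]
      have e2 : (2 * √(r : ℝ))⁻¹ * (2 * √r)⁻¹ = (4 * (r : ℝ))⁻¹ := by
        rw [← mul_inv]; congr 1
        nlinarith [Real.mul_self_sqrt hr0.le]
      rw [e2, inv_mul_eq_div]
      gcongr
      exact (le_abs_self _).trans (h z hz z' hz')
    have h2 := (le_abs_self _).trans (abs_dotProduct_mulVec_le M (x - u) y)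
    have h3 := (le_abs_self _).trans (abs_dotProduct_mulVec_le M u (y - v))
    have h4 : ‖WithLp.toLp 2 (x - u)‖ * ‖WithLp.toLp 2 y‖ ≤ 1 / 4 := by rw [hy]; linarith
    have h5 : ‖WithLp.toLp 2 u‖ * ‖WithLp.toLp 2 (y - v)‖ ≤ 5 / 4 * (1 / 4) := by gcongr
    have h6 := mul_le_mul_of_nonneg_left h4 hM
    have h7 := mul_le_mul_of_nonneg_left h5 hM
    rw [e]; linarith
  have : D / (4 * r) = D / r / 4 := by field_simp
  rw [this] at key
  have : 0 ≤ D / r := by positivity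
  linarith

lemma specNorm_pow_le_sum_latticeNet {r : ℕ} (hr : 0 < r) (M : Matrix (Fin r) (Fin r) ℝ) (m : ℕ) :
    specNorm M ^ (2 * m) ≤ (∑ z ∈ latticeNet r, ∑ z' ∈ latticeNet r,
      ((fun i => (z i : ℝ)) ⬝ᵥ M.mulVec fun i => (z' i : ℝ)) ^ (2 * m)) / r ^ (2 * m) := by
  set φ : (Fin r → ℤ) × (Fin r → ℤ) → ℝ := fun w =>
    (fun i => (w.1 i : ℝ)) ⬝ᵥ M.mulVec fun i => (w.2 i : ℝ)
  have h0 : (0 : Fin r → ℤ) ∈ latticeNet r := mem_latticeNet.2 (by simp)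
  obtain ⟨w, hw, hmax⟩ := Finset.exists_max_image (latticeNet r ×ˢ latticeNet r) (fun w => |φ w|)
    ⟨(0, 0), Finset.mk_mem_product h0 h0⟩
  have h1 := specNorm_le_of_latticeNet hr (M := M) (abs_nonneg (φ w))
    fun z hz z' hz' => hmax (z, z') (Finset.mk_mem_product hz hz')
  calc specNorm M ^ (2 * m) ≤ (|φ w| / r) ^ (2 * m) := by
        gcongr; exact specNorm_nonneg M
    _ = φ w ^ (2 * m) / r ^ (2 * m) := by rw [div_pow, pow_mul, sq_abs, ← pow_mul]
    _ ≤ _ := by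
        gcongr
        rw [← Finset.sum_product']
        exact Finset.single_le_sum (f := fun w => φ w ^ (2 * m))
          (fun w _ => (even_two_mul m).pow_nonneg _) hw

/-- A centred value on three equally likely outcomes. -/
def triVal : Fin 3 → ℝ := ![2, -1, -1]

/-- The symmetric matrix with the three-valued entries prescribed by `y`. -/
def triMat {r : ℕ} (y : Fin r × Fin r → Fin 3) : Matrix (Fin r) (Fin r) ℝ :=
  Matrix.of fun a b => triVal (y (edgeKey a b))

lemma sum_triVal (F : ℝ → ℝ) : ∑ c, F (triVal c) = F 2 + 2 * F (-1) := by
  simp [Fin.sum_univ_three, triVal]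
  ring

lemma sum_prod_eq {κ : Type*} [Fintype κ] [DecidableEq κ] (g : κ → Fin 3 → ℝ) :
    ∑ y : κ → Fin 3, ∏ x, g x (y x) = ∏ x, ∑ c, g x c := by
  rw [Finset.prod_univ_sum, Fintype.piFinset_univ]

open Classical in
lemma le_sum_prod_triVal {ι κ : Type*} [Fintype ι] [Fintype κ] [DecidableEq κ] (f : ι → κ) :
    (if NoSingleton f then (1 : ℝ) else 0) * 3 ^ Fintype.card κ ≤
      ∑ y : κ → Fin 3, ∏ t, triVal (y (f t)) := by
  have h1 := le_prod_moments f (fun j => ((2 : ℝ) ^ j + 2 * (-1) ^ j) / 3)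
    (by norm_num) (by norm_num) (fun j hj => by
      have : (2 : ℝ) ^ 2 ≤ 2 ^ j := pow_le_pow_right₀ (by norm_num) hj
      rcases neg_one_pow_eq_or ℝ j with h | h
      · rw [h]; linarith
      · rcases Nat.lt_or_ge 2 j with h3 | h3
        · have : (2 : ℝ) ^ 3 ≤ 2 ^ j := pow_le_pow_right₀ (by norm_num) h3
          rw [h]; linarith
        · have : j = 2 := by omega
          subst this; norm_num at h)
  have h2 : ∑ y : κ → Fin 3, ∏ t, triVal (y (f t)) = ∏ x,
      (3 * (((2 : ℝ) ^ (Finset.univ.filter fun t => f t = x).card +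
        2 * (-1) ^ (Finset.univ.filter fun t => f t = x).card) / 3)) := by
    rw [Finset.prod_congr rfl (g := fun x =>
      ∑ c, triVal c ^ (Finset.univ.filter fun t => f t = x).card)
      (fun x _ => by rw [sum_triVal fun v => v ^ _]; ring), ← sum_prod_eq]
    refine Finset.sum_congr rfl fun y _ => ?_
    rw [← Finset.prod_fiberwise Finset.univ f]
    refine Finset.prod_congr rfl fun x _ => ?_
    rw [Finset.prod_congr rfl (g := fun _ => triVal (y x))
      (fun t ht => by rw [(Finset.mem_filter.1 ht).2]), Finset.prod_const]
  rw [h2, Finset.prod_mul_distrib, Finset.prod_const, Finset.card_univ, mul_comm]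
  refine mul_le_mul_of_nonneg_left ?_ (by positivity)
  refine h1.trans_eq (Finset.prod_congr rfl fun x _ => ?_)
  congr!

lemma exp_le_add_exp_sq (x : ℝ) : Real.exp x ≤ x + Real.exp (x ^ 2) := by
  have h1 := Real.add_one_le_exp (x ^ 2)
  by_cases hx : |x| ≤ 1
  · have := (abs_le.1 (Real.abs_exp_sub_one_sub_id_le hx)).2
    linarith
  · rcases lt_abs.1 (not_le.1 hx) with h | h
    · have : Real.exp x ≤ Real.exp (x ^ 2) := Real.exp_le_exp.2 (by nlinarith)
      linarith
    · have : Real.exp x ≤ 1 := Real.exp_le_one_iff.2 (by linarith)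
      nlinarith

lemma sum_exp_triVal_le (t : ℝ) : ∑ c, Real.exp (t * triVal c) ≤ 3 * Real.exp (4 * t ^ 2) := by
  rw [sum_triVal fun v => Real.exp (t * v)]
  have h1 := exp_le_add_exp_sq (t * 2)
  have h2 := exp_le_add_exp_sq (t * -1)
  have h3 : Real.exp ((t * -1) ^ 2) ≤ Real.exp (4 * t ^ 2) :=
    Real.exp_le_exp.2 (by nlinarith [sq_nonneg t])
  rw [show (t * 2) ^ 2 = 4 * t ^ 2 by ring] at h1
  linarith

lemma sum_exp_linear_le {κ : Type*} [Fintype κ] [DecidableEq κ] (c : κ → ℝ) :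
    ∑ y : κ → Fin 3, Real.exp (∑ x, c x * triVal (y x)) ≤
      3 ^ Fintype.card κ * Real.exp (4 * ∑ x, c x ^ 2) := by
  simp_rw [Real.exp_sum]
  rw [sum_prod_eq fun x v => Real.exp (c x * triVal v)]
  refine (Finset.prod_le_prod (fun _ _ => Finset.sum_nonneg fun _ _ => (Real.exp_pos _).le)
    fun x _ => sum_exp_triVal_le (c x)).trans_eq ?_
  rw [Finset.prod_mul_distrib, Finset.prod_const, Finset.card_univ, ← Real.exp_sum,
    Finset.mul_sum]

lemma even_pow_le_factorial_mul_exp (m : ℕ) (t : ℝ) :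
    t ^ (2 * m) ≤ (2 * m).factorial * (Real.exp t + Real.exp (-t)) := by
  have h := Real.pow_div_factorial_le_exp |t| (abs_nonneg t) (2 * m)
  rw [div_le_iff₀ (by positivity), (even_two_mul m).pow_abs] at h
  refine h.trans ?_
  rw [mul_comm]
  gcongr
  have := Real.exp_pos t
  have := Real.exp_pos (-t)
  rcases abs_cases t with ⟨h, -⟩ | ⟨h, -⟩ <;> rw [h] <;> linarith

lemma sum_even_pow_linear_le {κ : Type*} [Fintype κ] [DecidableEq κ] (c : κ → ℝ) {m : ℕ}
    (hm : 0 < m) {R : ℝ} (hR : 0 < R) (hc : ∑ x, c x ^ 2 ≤ 98 * R ^ 2) :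
    ∑ y : κ → Fin 3, (∑ x, c x * triVal (y x)) ^ (2 * m) ≤
      3 ^ Fintype.card κ * (2 * (4 * m * R ^ 2 * Real.exp 392) ^ m) := by
  have hm' : (0 : ℝ) < m := by exact_mod_cast hm
  set l : ℝ := √m / R with hl
  have hl0 : 0 < l := by positivity
  have hl2 : l ^ 2 = m / R ^ 2 := by rw [hl, div_pow, Real.sq_sqrt hm'.le]
  have key : ∀ e : ℝ, e ^ 2 = 1 → ∑ y : κ → Fin 3, Real.exp (∑ x, (e * l * c x) * triVal (y x)) ≤
      3 ^ Fintype.card κ * Real.exp 392 ^ m := by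
    intro e he
    refine (sum_exp_linear_le fun x => e * l * c x).trans ?_
    rw [← Real.exp_nat_mul]
    refine mul_le_mul_of_nonneg_left (Real.exp_le_exp.2 ?_) (by positivity)
    simp_rw [mul_pow]
    rw [← Finset.mul_sum, he, hl2]
    calc 4 * (1 * (m / R ^ 2) * ∑ x, c x ^ 2) ≤ 4 * (1 * (m / R ^ 2) * (98 * R ^ 2)) := by gcongr
      _ = _ := by field_simp; norm_num
  have h1 : ∀ y : κ → Fin 3, (∑ x, c x * triVal (y x)) ^ (2 * m) ≤ (R ^ 2 / m) ^ m *
      ((2 * m).factorial * (Real.exp (∑ x, (1 * l * c x) * triVal (y x)) +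
        Real.exp (∑ x, (-1 * l * c x) * triVal (y x)))) := by
    intro y
    have h2 := even_pow_le_factorial_mul_exp m (l * ∑ x, c x * triVal (y x))
    have h3 : ∑ x, (1 * l * c x) * triVal (y x) = l * ∑ x, c x * triVal (y x) := by
      rw [Finset.mul_sum]; exact Finset.sum_congr rfl fun _ _ => by ring
    have h4 : ∑ x, (-1 * l * c x) * triVal (y x) = -(l * ∑ x, c x * triVal (y x)) := by
      rw [Finset.mul_sum, ← Finset.sum_neg_distrib]; exact Finset.sum_congr rfl fun _ _ => by ring
    rw [h3, h4]
    calc _ = (R ^ 2 / m) ^ m * (l * ∑ x, c x * triVal (y x)) ^ (2 * m) := by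
          rw [mul_pow, pow_mul l, hl2, ← mul_assoc, ← mul_pow,
            show R ^ 2 / m * (m / R ^ 2) = 1 by field_simp]
          simp
      _ ≤ _ := by gcongr
  refine (Finset.sum_le_sum fun y _ => h1 y).trans ?_
  rw [← Finset.mul_sum, ← Finset.mul_sum, Finset.sum_add_distrib]
  have h5 : ((2 * m).factorial : ℝ) ≤ (4 * m ^ 2) ^ m := by
    have : ((2 * m).factorial : ℝ) ≤ (2 * m : ℕ) ^ (2 * m) := by
      exact_mod_cast Nat.factorial_le_pow (2 * m)
    refine this.trans_eq ?_
    rw [pow_mul]; push_cast; ring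
  calc _ ≤ (R ^ 2 / m) ^ m * ((4 * (m : ℝ) ^ 2) ^ m * (3 ^ Fintype.card κ * Real.exp 392 ^ m +
        3 ^ Fintype.card κ * Real.exp 392 ^ m)) := by
        gcongr
        · exact key 1 (by norm_num)
        · exact key (-1) (by norm_num)
    _ = 3 ^ Fintype.card κ * (2 * (R ^ 2 / m * (4 * m ^ 2) * Real.exp 392) ^ m) := by
        rw [mul_pow, mul_pow]; ring
    _ = _ := by congr 3; field_simp

lemma sum_edge_fiber_sq_le {r : ℕ} (u v : Fin r → ℝ) :
    ∑ x, (∑ w : Fin r × Fin r with edgeKey w.1 w.2 = x, u w.1 * v w.2) ^ 2 ≤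
      2 * ((∑ i, u i ^ 2) * ∑ i, v i ^ 2) := by
  have h1 : ∀ x : Fin r × Fin r,
      (∑ w : Fin r × Fin r with edgeKey w.1 w.2 = x, u w.1 * v w.2) ^ 2 ≤
        2 * ∑ w : Fin r × Fin r with edgeKey w.1 w.2 = x, (u w.1 * v w.2) ^ 2 := by
    intro x
    refine sq_sum_le_card_mul_sum_sq.trans ?_
    gcongr
    have : (Finset.univ.filter fun w : Fin r × Fin r => edgeKey w.1 w.2 = x) ⊆
        {x, (x.2, x.1)} := by
      rintro ⟨a, b⟩ hw
      have hw := (Finset.mem_filter.1 hw).2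
      subst hw
      simp only [edgeKey, Finset.mem_insert, Finset.mem_singleton, Prod.mk.injEq]
      rcases le_total a b with h | h <;> simp [h]
    exact_mod_cast (Finset.card_le_card this).trans Finset.card_le_two
  refine (Finset.sum_le_sum fun x _ => h1 x).trans_eq ?_
  rw [← Finset.mul_sum, Finset.sum_fiberwise, Fintype.sum_prod_type, Finset.sum_mul_sum]
  simp_rw [mul_pow]

lemma dotProduct_triMat_mulVec {r : ℕ} (u v : Fin r → ℝ) (y : Fin r × Fin r → Fin 3) :
    u ⬝ᵥ (triMat y).mulVec v =
      ∑ x, (∑ w : Fin r × Fin r with edgeKey w.1 w.2 = x, u w.1 * v w.2) * triVal (y x) := by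
  have : ∀ x, (∑ w : Fin r × Fin r with edgeKey w.1 w.2 = x, u w.1 * v w.2) * triVal (y x) =
      ∑ w : Fin r × Fin r with edgeKey w.1 w.2 = x,
        u w.1 * v w.2 * triVal (y (edgeKey w.1 w.2)) := by
    intro x
    rw [Finset.sum_mul]
    exact Finset.sum_congr rfl fun w hw => by rw [(Finset.mem_filter.1 hw).2]
  simp_rw [this]
  rw [Finset.sum_fiberwise, Fintype.sum_prod_type]
  simp only [dotProduct, Matrix.mulVec, triMat, Matrix.of_apply, Finset.mul_sum]
  exact Finset.sum_congr rfl fun _ _ => Finset.sum_congr rfl fun _ _ => by ring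

/-- The absolute constant in the moment bound for three-valued random matrices. -/
noncomputable def triConst : ℝ := 512 ^ 4 * 2 * (4 * Real.exp 392)

lemma sum_specNorm_triMat_pow_le {r m : ℕ} (hr : 0 < r) (hm : 0 < m) (hrm : r ≤ 2 * m) :
    ∑ y : Fin r × Fin r → Fin 3, specNorm (triMat y) ^ (2 * m) ≤
      3 ^ Fintype.card (Fin r × Fin r) * (triConst * m) ^ m := by
  have hr' : (0 : ℝ) < r := by exact_mod_cast hr
  obtain ⟨K, hK⟩ : ∃ K : ℝ, K = 3 ^ Fintype.card (Fin r × Fin r) := ⟨_, rfl⟩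
  have hK0 : 0 < K := hK ▸ by positivity
  rw [← hK]
  have h1 : ∀ z ∈ latticeNet r, ∀ z' ∈ latticeNet r, ∑ y : Fin r × Fin r → Fin 3,
      ((fun i => (z i : ℝ)) ⬝ᵥ (triMat y).mulVec fun i => (z' i : ℝ)) ^ (2 * m) ≤
        K * (2 * (4 * m * r ^ 2 * Real.exp 392) ^ m) := by
    intro z hz z' hz'
    simp_rw [dotProduct_triMat_mulVec]
    rw [hK]
    refine sum_even_pow_linear_le (κ := Fin r × Fin r) (fun x => ∑ w : Fin r × Fin r with
      edgeKey w.1 w.2 = x, (z w.1 : ℝ) * z' w.2) hm hr' 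
      ((sum_edge_fiber_sq_le (fun i => (z i : ℝ)) fun i => (z' i : ℝ)).trans ?_)
    have h2 : ∀ z ∈ latticeNet r, ∑ i, (z i : ℝ) ^ 2 ≤ 7 * r := fun z hz => by
      exact_mod_cast mem_latticeNet.1 hz
    calc _ ≤ 2 * ((7 * (r : ℝ)) * (7 * r)) := by
          gcongr
          · exact h2 z hz
          · exact h2 z' hz'
      _ = _ := by ring
  calc _ ≤ ∑ y : Fin r × Fin r → Fin 3, (∑ z ∈ latticeNet r, ∑ z' ∈ latticeNet r,
        ((fun i => (z i : ℝ)) ⬝ᵥ (triMat y).mulVec fun i => (z' i : ℝ)) ^ (2 * m)) / r ^ (2 * m) :=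
        Finset.sum_le_sum fun y _ => specNorm_pow_le_sum_latticeNet hr _ m
    _ = (∑ z ∈ latticeNet r, ∑ z' ∈ latticeNet r, ∑ y : Fin r × Fin r → Fin 3,
        ((fun i => (z i : ℝ)) ⬝ᵥ (triMat y).mulVec fun i => (z' i : ℝ)) ^ (2 * m)) /
          r ^ (2 * m) := by
        rw [← Finset.sum_div, Finset.sum_comm]
        congr 1
        exact Finset.sum_congr rfl fun z _ => Finset.sum_comm
    _ ≤ (∑ z ∈ latticeNet r, ∑ z' ∈ latticeNet r, K * (2 * (4 * m * r ^ 2 * Real.exp 392) ^ m)) /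
          r ^ (2 * m) := by
        gcongr with z hz z' hz'
        exact h1 z hz z' hz'
    _ = ((latticeNet r).card : ℝ) ^ 2 * (K * (2 * (4 * m * Real.exp 392) ^ m)) := by
        simp only [Finset.sum_const, nsmul_eq_mul]
        rw [show (4 * m * (r : ℝ) ^ 2 * Real.exp 392) = (4 * m * Real.exp 392) * r ^ 2 by ring,
          mul_pow _ ((r : ℝ) ^ 2), ← pow_mul]
        field_simp
    _ ≤ (512 ^ r) ^ 2 * (K * (2 * (4 * m * Real.exp 392) ^ m)) := by
        gcongr
        exact card_latticeNet_le r
    _ ≤ (512 ^ (2 * m)) ^ 2 * (K * (2 ^ m * (4 * m * Real.exp 392) ^ m)) := by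
        gcongr
        · norm_num
        · exact le_self_pow₀ (by norm_num) hm.ne'
    _ = _ := by
        rw [triConst, ← pow_mul, show 2 * m * 2 = 4 * m by ring, pow_mul, mul_left_comm,
          ← mul_pow, ← mul_pow]
        congr 2
        ring

open Classical in
/-- The number of walks on `r` vertices which use no edge exactly once. -/
lemma sum_noSingleton_walks_le {r m : ℕ} (hr : 0 < r) (hm : 0 < m) (hrm : r ≤ 2 * m) :
    ∑ w : Fin (2 * m + 1) → Fin r, (if NoSingleton (walkKey w) then (1 : ℝ) else 0) ≤
      r * (triConst * m) ^ m := by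
  obtain ⟨K, hK⟩ : ∃ K : ℝ, K = 3 ^ Fintype.card (Fin r × Fin r) := ⟨_, rfl⟩
  have hK0 : 0 < K := hK ▸ by positivity
  have h1 : (∑ w : Fin (2 * m + 1) → Fin r, (if NoSingleton (walkKey w) then (1 : ℝ) else 0)) * K ≤
      ∑ y : Fin r × Fin r → Fin 3, ∑ i, (triMat y ^ (2 * m)).mulVec (fun _ => 1) i := by
    calc _ ≤ ∑ w : Fin (2 * m + 1) → Fin r, ∑ y : Fin r × Fin r → Fin 3,
          ∏ t, triVal (y (walkKey w t)) := by
          rw [Finset.sum_mul, hK]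
          exact Finset.sum_le_sum fun w _ => le_sum_prod_triVal (walkKey w)
      _ = _ := by
          rw [Finset.sum_comm]
          refine Finset.sum_congr rfl fun y _ => ?_
          rw [← (Fin.consEquiv fun _ => Fin r).sum_comp, Fintype.sum_prod_type]
          refine Finset.sum_congr rfl fun i _ => ?_
          rw [pow_mulVec_eq_sum_walks]
          refine Finset.sum_congr rfl fun b _ => ?_
          rw [mul_one]
          rfl
  have h2 : ∀ y : Fin r × Fin r → Fin 3,
      ∑ i, (triMat y ^ (2 * m)).mulVec (fun _ => 1) i ≤ r * specNorm (triMat y) ^ (2 * m) := by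
    intro y
    have h3 : ‖WithLp.toLp 2 (fun _ : Fin r => (1 : ℝ))‖ ^ 2 = r := by
      rw [norm_toLp_sq]; simp
    have h4 := (le_abs_self _).trans
      (abs_dotProduct_mulVec_le (triMat y ^ (2 * m)) (fun _ => 1) (fun _ => 1))
    rw [← sq, h3] at h4
    have h5 := specNorm_pow_le (triMat y) (k := 2 * m) (by omega)
    calc _ = (fun _ => 1) ⬝ᵥ (triMat y ^ (2 * m)).mulVec (fun _ => 1) := by simp [dotProduct]
      _ ≤ _ := h4
      _ ≤ specNorm (triMat y) ^ (2 * m) * r := by gcongr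
      _ = _ := mul_comm _ _
  have h6 : (∑ w : Fin (2 * m + 1) → Fin r, (if NoSingleton (walkKey w) then (1 : ℝ) else 0)) * K ≤
      (r * (triConst * m) ^ m) * K := by
    refine h1.trans ((Finset.sum_le_sum fun y _ => h2 y).trans ?_)
    rw [← Finset.mul_sum]
    calc _ ≤ r * (K * (triConst * m) ^ m) := by
          gcongr
          exact hK ▸ sum_specNorm_triMat_pow_le hr hm hrm
      _ = _ := by ring
  exact le_of_mul_le_mul_right h6 hK0

/-- The edge probability of a pair of vertices. -/
noncomputable def edgeProb {n : ℕ} (p q : ℝ) (i j : Fin n) : ℝ :=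
  if ((i : ℕ) < n / 2 ↔ (j : ℕ) < n / 2) then p else q

/-- The centred adjacency matrix. -/
noncomputable def noise {n : ℕ} (p q : ℝ) (ω : Fin n → Fin n → Bool) : Matrix (Fin n) (Fin n) ℝ :=
  Matrix.of fun i j => if i = j then 0 else
    (if ω (min i j) (max i j) then 1 else 0) - edgeProb p q (min i j) (max i j)

lemma edgeProb_comm {n : ℕ} (p q : ℝ) (i j : Fin n) : edgeProb p q i j = edgeProb p q j i := by
  simp only [edgeProb, iff_comm]

lemma edgeProb_min_max {n : ℕ} (p q : ℝ) (i j : Fin n) :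
    edgeProb p q (min i j) (max i j) = edgeProb p q i j := by
  rcases le_total i j with h | h
  · simp [h]
  · simp [h, edgeProb_comm]

lemma edgeProb_mem {n : ℕ} {p q : ℝ} (hq : 0 ≤ q) (hqp : q ≤ p) (i j : Fin n) :
    0 ≤ edgeProb p q i j ∧ edgeProb p q i j ≤ p := by
  unfold edgeProb
  split_ifs
  · exact ⟨hq.trans hqp, le_rfl⟩
  · exact ⟨hq, hqp⟩

lemma noise_transpose {n : ℕ} (p q : ℝ) (ω : Fin n → Fin n → Bool) :
    (noise p q ω)ᵀ = noise p q ω := by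
  ext i j
  simp only [noise, Matrix.transpose_apply, Matrix.of_apply, min_comm j i, max_comm j i,
    eq_comm (a := j) (b := i)]

lemma isProbabilityMeasure_bern {p : ℝ} (h0 : 0 ≤ p) (h1 : p ≤ 1) :
    IsProbabilityMeasure (bern p) := by
  constructor
  simp only [bern, Measure.add_apply, Measure.smul_apply, measure_univ, smul_eq_mul, mul_one]
  rw [← ENNReal.ofReal_add (by linarith) h0]
  simp

lemma integral_bern {p : ℝ} (h0 : 0 ≤ p) (h1 : p ≤ 1) (F : Bool → ℝ) :
    ∫ b, F b ∂bern p = (1 - p) * F false + p * F true := by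
  have hf : ∀ a : ℝ, ∀ b : Bool, Integrable F (ENNReal.ofReal a • Measure.dirac b) := fun a b => by
    have : IsFiniteMeasure (ENNReal.ofReal a • Measure.dirac b) :=
      Measure.smul_finite _ ENNReal.ofReal_ne_top
    exact Integrable.of_finite
  rw [bern, integral_add_measure (hf _ _) (hf _ _), integral_smul_measure, integral_smul_measure,
    integral_dirac, integral_dirac, ENNReal.toReal_ofReal (by linarith), ENNReal.toReal_ofReal h0]
  simp

section

variable {n : ℕ} {p q : ℝ}

lemma isProbabilityMeasure_bern_edgeProb (hq : 0 ≤ q) (hqp : q ≤ p) (hp : p ≤ 1) (i j : Fin n) :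
    IsProbabilityMeasure
      (bern (if ((i : ℕ) < n / 2 ↔ (j : ℕ) < n / 2) then p else q)) :=
  isProbabilityMeasure_bern (edgeProb_mem hq hqp i j).1 ((edgeProb_mem hq hqp i j).2.trans hp)

lemma isProbabilityMeasure_sbm (hq : 0 ≤ q) (hqp : q ≤ p) (hp : p ≤ 1) :
    IsProbabilityMeasure (sbm n p q) := by
  have := isProbabilityMeasure_bern_edgeProb (n := n) hq hqp hp
  unfold sbm
  infer_instance

lemma integral_sbm_prod (hq : 0 ≤ q) (hqp : q ≤ p) (hp : p ≤ 1) (F : Fin n → Fin n → Bool → ℝ) :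
    ∫ ω, ∏ i, ∏ j, F i j (ω i j) ∂sbm n p q =
      ∏ i, ∏ j, ((1 - edgeProb p q i j) * F i j false + edgeProb p q i j * F i j true) := by
  have := isProbabilityMeasure_bern_edgeProb (n := n) hq hqp hp
  unfold sbm
  rw [integral_fintype_prod_eq_prod (f := fun i (y : Fin n → Bool) => ∏ j, F i j (y j))]
  refine Finset.prod_congr rfl fun i _ => ?_
  rw [integral_fintype_prod_eq_prod (f := fun j b => F i j b)]
  refine Finset.prod_congr rfl fun j _ => ?_
  exact integral_bern (edgeProb_mem hq hqp i j).1 ((edgeProb_mem hq hqp i j).2.trans hp) _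

lemma abs_centered_moment_le {r : ℝ} (h0 : 0 ≤ r) (h1 : r ≤ 1) {j : ℕ} (hj : 2 ≤ j) :
    |(1 - r) * (0 - r) ^ j + r * (1 - r) ^ j| ≤ r := by
  have h2 : |(0 - r) ^ j| ≤ r ^ 2 := by
    rw [abs_pow, zero_sub, abs_neg, abs_of_nonneg h0]
    exact pow_le_pow_of_le_one h0 h1 hj
  have h3 : |(1 - r) ^ j| ≤ (1 - r) ^ 2 := by
    rw [abs_pow, abs_of_nonneg (by linarith)]
    exact pow_le_pow_of_le_one (by linarith) (by linarith) hj
  calc _ ≤ |(1 - r) * (0 - r) ^ j| + |r * (1 - r) ^ j| := abs_add_le _ _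
    _ = (1 - r) * |(0 - r) ^ j| + r * |(1 - r) ^ j| := by
        rw [abs_mul, abs_mul, abs_of_nonneg h0, abs_of_nonneg (by linarith : 0 ≤ 1 - r)]
    _ ≤ (1 - r) * r ^ 2 + r * (1 - r) ^ 2 := by
        gcongr
    _ ≤ r := by nlinarith [sq_nonneg r, mul_nonneg h0 h0]

open Classical in
lemma abs_integral_noise_prod_le {ι : Type*} [Fintype ι] (hq : 0 ≤ q) (hqp : q ≤ p) (hp : p ≤ 1)
    (a b : ι → Fin n) :
    |∫ ω, ∏ t, noise p q ω (a t) (b t) ∂sbm n p q| ≤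
      if NoSingleton (fun t => edgeKey (a t) (b t)) then
        p ^ (Finset.univ.image fun t => edgeKey (a t) (b t)).card else 0 := by
  have hp0 : 0 ≤ p := hq.trans hqp
  by_cases hab : ∃ t, a t = b t
  · obtain ⟨t, ht⟩ := hab
    have : ∀ ω, ∏ t, noise p q ω (a t) (b t) = 0 := fun ω =>
      Finset.prod_eq_zero (Finset.mem_univ t) (by simp [noise, ht])
    simp only [this, integral_zero, abs_zero]
    split_ifs <;> positivity
  push Not at hab
  set f : ι → Fin n × Fin n := fun t => edgeKey (a t) (b t) with hf
  set μ : Fin n × Fin n → ℕ := fun x => (Finset.univ.filter fun t => f t = x).card with hμ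
  have h1 : ∀ ω : Fin n → Fin n → Bool, ∏ t, noise p q ω (a t) (b t) =
      ∏ i, ∏ j, ((if ω i j then 1 else 0) - edgeProb p q i j) ^ μ (i, j) := by
    intro ω
    rw [← Fintype.prod_prod_type' (f := fun i j =>
      ((if ω i j then 1 else 0) - edgeProb p q i j) ^ μ (i, j)),
      ← Finset.prod_fiberwise Finset.univ f]
    refine Finset.prod_congr rfl fun x _ => ?_
    rw [hμ, ← Finset.prod_const]
    refine Finset.prod_congr rfl fun t ht => ?_
    have : f t = x := (Finset.mem_filter.1 ht).2
    subst this
    simp [noise, hab t, hf, edgeKey]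
  simp_rw [h1]
  rw [integral_sbm_prod hq hqp hp fun i j b => ((if b then 1 else 0) - edgeProb p q i j) ^ μ (i, j),
    ← Fintype.prod_prod_type' (f := fun i j =>
      ((1 - edgeProb p q i j) * ((if false then 1 else 0) - edgeProb p q i j) ^ μ (i, j) +
      edgeProb p q i j * ((if true then 1 else 0) - edgeProb p q i j) ^ μ (i, j)))]
  simp only [Bool.false_eq_true, if_false, if_true]
  have h2 := abs_prod_moments_le f (fun x j => (1 - edgeProb p q x.1 x.2) *
    (0 - edgeProb p q x.1 x.2) ^ j + edgeProb p q x.1 x.2 * (1 - edgeProb p q x.1 x.2) ^ j) p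
    (fun x => by ring) (fun x => by ring) (fun x j hj =>
      have h := edgeProb_mem hq hqp x.1 x.2
      (abs_centered_moment_le h.1 (h.2.trans hp) hj).trans h.2)
  convert h2

lemma integrable_sbm (hq : 0 ≤ q) (hqp : q ≤ p) (hp : p ≤ 1) (F : (Fin n → Fin n → Bool) → ℝ) :
    Integrable F (sbm n p q) := by
  have := isProbabilityMeasure_sbm (n := n) hq hqp hp
  exact Integrable.of_finite

lemma sbm_real_le_of_integral_pow_le (hq : 0 ≤ q) (hqp : q ≤ p) (hp : p ≤ 1)
    (F : (Fin n → Fin n → Bool) → ℝ) (m : ℕ) {T B : ℝ} (hT : 0 < T)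
    (h : ∫ ω, F ω ^ (2 * m) ∂sbm n p q ≤ B) :
    (sbm n p q).real {ω | T ≤ |F ω|} ≤ B / T ^ (2 * m) := by
  have := isProbabilityMeasure_sbm (n := n) hq hqp hp
  rw [le_div_iff₀ (by positivity), mul_comm]
  refine le_trans ?_ ((mul_meas_ge_le_integral_of_nonneg (μ := sbm n p q)
    (f := fun ω => F ω ^ (2 * m))
    (Filter.Eventually.of_forall fun ω => (even_two_mul m).pow_nonneg _)
    (integrable_sbm hq hqp hp _) (T ^ (2 * m))).trans h)
  refine mul_le_mul_of_nonneg_left (measureReal_mono (fun ω h => ?_) (by finiteness))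
    (by positivity)
  change T ≤ |F ω| at h
  change T ^ (2 * m) ≤ F ω ^ (2 * m)
  calc T ^ (2 * m) ≤ |F ω| ^ (2 * m) := by gcongr
    _ = _ := (even_two_mul m).pow_abs _

/-- High moments of the entries of a power of the noise matrix applied to a bounded vector. -/
lemma integral_noise_pow_mulVec_pow_le (hq : 0 ≤ q) (hqp : q ≤ p) (hp : p ≤ 1) (hp0 : 0 < p)
    {f : Fin n → ℝ} (hf : ∀ i, |f i| ≤ 1) (i : Fin n) (j M : ℕ)
    (hnp : 2 * ((M * j : ℕ) : ℝ) + 1 ≤ n * p) :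
    ∫ ω, ((noise p q ω ^ j).mulVec f i) ^ (2 * M) ∂sbm n p q ≤
      (4 * (n * p) * (2 * (M * j : ℕ) + 1)) ^ (M * j) := by
  classical
  let ι := Fin (2 * M) × Fin j
  let src : (ι → Fin n) → ι → Fin n := fun b x =>
    (Fin.cons i (fun t => b (x.1, t)) : Fin (j + 1) → Fin n) x.2.castSucc
  let ψ : (ι → Fin n) → ℝ := fun b => ∏ u, f ((Fin.cons i (fun t => b (u, t)) :
    Fin (j + 1) → Fin n) (Fin.last j))
  have h1 : ∀ ω, ((noise p q ω ^ j).mulVec f i) ^ (2 * M) =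
      ∑ b : ι → Fin n, ψ b * ∏ x, noise p q ω (src b x) (b x) := by
    intro ω
    rw [pow_mulVec_eq_sum_walks, Fintype.sum_pow,
      ← (Equiv.curry (Fin (2 * M)) (Fin j) (Fin n)).sum_comp]
    refine Finset.sum_congr rfl fun b _ => ?_
    rw [Finset.prod_mul_distrib, mul_comm, Fintype.prod_prod_type]
    rfl
  have hψ : ∀ b, |ψ b| ≤ 1 := fun b => by
    rw [Finset.abs_prod]
    exact Finset.prod_le_one (fun _ _ => abs_nonneg _) fun _ _ => hf _
  simp_rw [h1]
  rw [integral_finsetSum _ fun b _ => integrable_sbm hq hqp hp _]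
  simp_rw [integral_const_mul]
  refine le_trans (Finset.sum_le_sum fun b _ => ?_) (sum_sparse_words_le i hp0 (M * j)
    (ι := ι) (by simp [ι, mul_assoc]) (by simpa using hnp)) |>.trans_eq (by simp)
  have h2 := abs_integral_noise_prod_le hq hqp hp (src b) b
  have h3 : ((Finset.univ.image b).erase i).card ≤
      (Finset.univ.image fun t => edgeKey (src b t) (b t)).card := by
    refine card_discovered_le_card_edges i (src b) b (fun x => x.2) fun x => ?_
    obtain ⟨u, t⟩ := x
    rcases Nat.eq_zero_or_pos (t : ℕ) with h0 | h0
    · left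
      have : t.castSucc = 0 := by ext; simpa using h0
      simp [src, this]
    · right
      refine ⟨(u, ⟨t - 1, by omega⟩), by simp; omega, ?_⟩
      have : t.castSucc = (⟨t - 1, by omega⟩ : Fin j).succ := by ext; simp; omega
      simp only [src, this, Fin.cons_succ]
  calc _ ≤ |ψ b| * |∫ ω, ∏ x, noise p q ω (src b x) (b x) ∂sbm n p q| := by
        rw [← abs_mul]; exact le_abs_self _
    _ ≤ 1 * _ := mul_le_mul (hψ b) h2 (abs_nonneg _) zero_le_one
    _ ≤ _ := by
        rw [one_mul]
        split_ifs with h4 h5 h5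
        · exact pow_le_pow_of_le_one hp0.le hp (by convert h3)
        · have h6 := h4.two_mul_card_image_le
          simp only [ι, Fintype.card_prod, Fintype.card_fin, mul_assoc] at h6
          refine absurd (h3.trans ?_) h5
          convert (Nat.mul_le_mul_left_iff (by norm_num : 0 < 2)).1 h6
        · positivity
        · exact le_rfl

lemma noise_pow_mulVec_tail (hq : 0 ≤ q) (hqp : q ≤ p) (hp : p ≤ 1) (hp0 : 0 < p)
    {f : Fin n → ℝ} (hf : ∀ i, |f i| ≤ 1) (i : Fin n) (j M : ℕ)
    (hnp : 2 * ((M * j : ℕ) : ℝ) + 1 ≤ n * p) {T : ℝ} (hT : 0 < T) :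
    (sbm n p q).real {ω | T ^ j ≤ |(noise p q ω ^ j).mulVec f i|} ≤
      (4 * (n * p) * (2 * (M * j : ℕ) + 1) / T ^ 2) ^ (M * j) := by
  refine (sbm_real_le_of_integral_pow_le hq hqp hp _ M (pow_pos hT j)
    (integral_noise_pow_mulVec_pow_le hq hqp hp hp0 hf i j M hnp)).trans_eq ?_
  rw [div_pow, ← pow_mul, ← pow_mul]
  congr 2
  ring

lemma specNorm_sq_le_sum_sq (M : Matrix (Fin n) (Fin n) ℝ) :
    specNorm M ^ 2 ≤ ∑ i, ∑ j, M i j ^ 2 := by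
  have h0 : 0 ≤ ∑ i, ∑ j, M i j ^ 2 := by positivity
  have h : specNorm M ≤ √(∑ i, ∑ j, M i j ^ 2) := by
    refine specNorm_le_of_bilinear (Real.sqrt_nonneg _) fun x y hx hy => ?_
    refine (le_abs_self _).trans ((abs_dotProduct_le _ _).trans ?_)
    rw [hx, one_mul]
    refine Real.le_sqrt_of_sq_le ?_
    rw [norm_toLp_sq]
    refine Finset.sum_le_sum fun i _ => ?_
    have h := Finset.sum_mul_sq_le_sq_mul_sq Finset.univ (M i) y
    rwa [← norm_toLp_sq y, hy, one_pow, mul_one] at h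
  calc specNorm M ^ 2 ≤ √(∑ i, ∑ j, M i j ^ 2) ^ 2 := by gcongr; exact specNorm_nonneg _
    _ = _ := Real.sq_sqrt h0

lemma specNorm_pow_two_pow {M : Matrix (Fin n) (Fin n) ℝ} (hM : Mᵀ = M) (l : ℕ) :
    specNorm (M ^ 2 ^ l) = specNorm M ^ 2 ^ l := by
  have : IsSelfAdjoint (Matrix.toEuclideanCLM (𝕜 := ℝ) M) := by
    refine IsSelfAdjoint.map ?_ (Matrix.toEuclideanCLM (𝕜 := ℝ))
    rw [IsSelfAdjoint, Matrix.star_eq_conjTranspose, Matrix.conjTranspose_eq_transpose_of_trivial,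
      hM]
  rw [specNorm, map_pow]
  exact this.norm_pow_two_pow l

lemma specNorm_pow_le_trace {M : Matrix (Fin n) (Fin n) ℝ} (hM : Mᵀ = M) (l : ℕ) :
    specNorm M ^ (2 * 2 ^ l) ≤ ∑ i, (M ^ (2 * 2 ^ l)).mulVec (Pi.single i 1) i := by
  rw [mul_comm 2, pow_mul, ← specNorm_pow_two_pow hM]
  refine (specNorm_sq_le_sum_sq _).trans_eq (Finset.sum_congr rfl fun i _ => ?_)
  rw [Matrix.mulVec_single_one, Matrix.col_apply, pow_mul, sq (M ^ 2 ^ l), Matrix.mul_apply]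
  refine Finset.sum_congr rfl fun j _ => ?_
  rw [sq]
  congr 1
  rw [← Matrix.transpose_apply (M ^ 2 ^ l), Matrix.transpose_pow, hM]

lemma integral_noise_specNorm_pow_le (hq : 0 ≤ q) (hqp : q ≤ p) (hp : p ≤ 1) {l r : ℕ}
    (hr : n * p + (2 ^ l : ℕ) ≤ r) (hr2 : r ≤ 2 * 2 ^ l) :
    ∫ ω, specNorm (noise p q ω) ^ (2 * 2 ^ l) ∂sbm n p q ≤ n * (triConst * (2 ^ l : ℕ)) ^ 2 ^ l := by
  classical
  have hp0 : 0 ≤ p := hq.trans hqp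
  have hr0 : 0 < r := by
    have h1 : (0 : ℝ) < (2 ^ l : ℕ) := by positivity
    have : (0 : ℝ) < r := by nlinarith [mul_nonneg (Nat.cast_nonneg (α := ℝ) n) hp0]
    exact_mod_cast this
  have hr0' : (0 : ℝ) < r := by exact_mod_cast hr0
  refine (integral_mono (integrable_sbm hq hqp hp _) (integrable_sbm hq hqp hp _)
    fun ω => specNorm_pow_le_trace (noise_transpose p q ω) l).trans ?_
  simp only [pow_mulVec_eq_sum_walks]
  rw [integral_finsetSum _ fun i _ => integrable_sbm hq hqp hp _]
  calc _ ≤ ∑ i : Fin n, ∑ b : Fin (2 * 2 ^ l) → Fin n,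
        (if NoSingleton (walkKey (Fin.cons i b : Fin (2 * 2 ^ l + 1) → Fin n)) then
          p ^ (Finset.univ.image (walkKey (Fin.cons i b : Fin (2 * 2 ^ l + 1) → Fin n))).card
          else 0) := by
        refine Finset.sum_le_sum fun i _ => ?_
        rw [integral_finsetSum _ fun b _ => integrable_sbm hq hqp hp _]
        refine Finset.sum_le_sum fun b _ => ?_
        rw [integral_mul_const]
        have h2 := abs_integral_noise_prod_le hq hqp hp
          (fun t : Fin (2 * 2 ^ l) => (Fin.cons i b : Fin (2 * 2 ^ l + 1) → Fin n) t.castSucc) b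
        have h3 : ∀ x : Fin n, |(Pi.single i 1 : Fin n → ℝ) x| ≤ 1 := fun x => by
          rw [Pi.single_apply]; split_ifs <;> simp
        refine (le_abs_self _).trans ?_
        rw [abs_mul]
        refine (mul_le_mul h2 (h3 _) (abs_nonneg _) ((abs_nonneg _).trans h2)).trans_eq ?_
        rw [mul_one]
        rfl
    _ = ∑ w : Fin (2 * 2 ^ l + 1) → Fin n, (if NoSingleton (walkKey w) then
          p ^ (Finset.univ.image (walkKey w)).card else 0) := by
        rw [← (Fin.consEquiv fun _ => Fin n).sum_comp, Fintype.sum_prod_type]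
        rfl
    _ ≤ n / r * ∑ w : Fin (2 * 2 ^ l + 1) → Fin r,
          (if NoSingleton (walkKey w) then (1 : ℝ) else 0) := by
        have := sum_sparse_walks_le hp0 hp hr0 hr
        convert this
    _ ≤ n / r * (r * (triConst * (2 ^ l : ℕ)) ^ 2 ^ l) := by
        gcongr
        have := sum_noSingleton_walks_le hr0 (by positivity) hr2
        convert this
    _ = _ := by field_simp

lemma noise_specNorm_tail (hq : 0 ≤ q) (hqp : q ≤ p) (hp : p ≤ 1) {l r : ℕ}
    (hr : n * p + (2 ^ l : ℕ) ≤ r) (hr2 : r ≤ 2 * 2 ^ l) {T : ℝ} (hT : 0 < T) :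
    (sbm n p q).real {ω | T ≤ specNorm (noise p q ω)} ≤
      n * (triConst * (2 ^ l : ℕ) / T ^ 2) ^ 2 ^ l := by
  have := sbm_real_le_of_integral_pow_le hq hqp hp _ _ hT
    (integral_noise_specNorm_pow_le (n := n) hq hqp hp hr hr2)
  simp only [abs_of_nonneg (specNorm_nonneg _)] at this
  refine this.trans_eq ?_
  rw [div_pow, pow_mul T, mul_div_assoc]

end

section

variable {n : ℕ} {B H : Matrix (Fin n) (Fin n) ℝ} {s : Fin n → ℝ} {β δ : ℝ} {k : ℕ}

lemma pow_mulVec_eq_of_rank_two_perturbation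
    (hH : ∀ i j, H i j = B i j + s i * s j / n + β / n) (f : Fin n → ℝ) (j : ℕ) (i : Fin n) :
    (H ^ j).mulVec f i = (B ^ j).mulVec f i + ∑ l ∈ Finset.range j,
      ((∑ x, s x * (H ^ l).mulVec f x) / n * (B ^ (j - 1 - l)).mulVec s i +
        β * (∑ x, (H ^ l).mulVec f x) / n * (B ^ (j - 1 - l)).mulVec (fun _ => 1) i) := by
  have hv : ∀ v : Fin n → ℝ, H.mulVec v = B.mulVec v + (((∑ x, s x * v x) / n) • s +
      (β * (∑ x, v x) / n) • fun _ => (1 : ℝ)) := by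
    intro v
    ext i
    simp only [Matrix.mulVec, dotProduct, hH, Pi.add_apply, Pi.smul_apply, smul_eq_mul,
      add_mul, Finset.sum_add_distrib, mul_one, add_assoc]
    congr 2
    · rw [Finset.sum_div, Finset.sum_mul]
      exact Finset.sum_congr rfl fun _ _ => by ring
    · rw [← Finset.mul_sum]; ring
  have key : ∀ j, (H ^ j).mulVec f = (B ^ j).mulVec f + ∑ l ∈ Finset.range j,
      (((∑ x, s x * (H ^ l).mulVec f x) / n) • (B ^ (j - 1 - l)).mulVec s +
        (β * (∑ x, (H ^ l).mulVec f x) / n) • (B ^ (j - 1 - l)).mulVec fun _ => 1) := by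
    intro j
    induction j with
    | zero => simp
    | succ j ih =>
      rw [pow_succ', ← Matrix.mulVec_mulVec, hv ((H ^ j).mulVec f), Finset.sum_range_succ]
      nth_rw 1 [ih]
      rw [Matrix.mulVec_add, Matrix.mulVec_mulVec, ← pow_succ', add_assoc]
      congr 1
      rw [Matrix.mulVec_sum]
      congr 1
      · refine Finset.sum_congr rfl fun l hl => ?_
        have : j + 1 - 1 - l = (j - 1 - l) + 1 := by have := Finset.mem_range.1 hl; omega
        rw [Matrix.mulVec_add, Matrix.mulVec_smul, Matrix.mulVec_smul, Matrix.mulVec_mulVec,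
          Matrix.mulVec_mulVec, ← pow_succ', this]
      · simp
  have := congrFun (key j) i
  rw [this]
  simp [Finset.sum_apply]

lemma abs_mean_le {v : Fin n → ℝ} {F : ℝ} (hn : 0 < n) (hv : ∀ i, |v i| ≤ F) :
    |(∑ x, v x) / n| ≤ F := by
  have : (0 : ℝ) < n := by exact_mod_cast hn
  rw [abs_div, Nat.abs_cast, div_le_iff₀ this]
  refine (Finset.abs_sum_le_sum_abs _ _).trans ((Finset.sum_le_sum fun i _ => hv i).trans_eq ?_)
  simp [mul_comm]

lemma sum_range_pow_le (h0 : 0 ≤ δ) (h1 : δ ≤ 1 / 2) (j : ℕ) :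
    ∑ l ∈ Finset.range j, δ ^ l ≤ 2 := by
  have h : ∑ l ∈ Finset.range j, δ ^ l ≤ 2 - 2 * δ ^ j := by
    induction j with
    | zero => simp
    | succ j ih =>
      rw [Finset.sum_range_succ, pow_succ]
      nlinarith [pow_nonneg h0 j]
  linarith [pow_nonneg h0 j]

lemma abs_pow_mulVec_sub_le (hn : 0 < n) (hs : ∀ i, s i ^ 2 = 1)
    (hδ0 : 0 ≤ δ) (hδ : k * δ ≤ 1 / 100) (hβ : |β| ≤ δ)
    (hH : ∀ i j, H i j = B i j + s i * s j / n + β / n)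
    (hB1 : ∀ j ≤ k, ∀ i, |(B ^ j).mulVec (fun _ => 1) i| ≤ δ ^ j)
    (hBs : ∀ j ≤ k, ∀ i, |(B ^ j).mulVec s i| ≤ δ ^ j)
    {f : Fin n → ℝ} (hf : ∀ j ≤ k, ∀ i, |(B ^ j).mulVec f i| ≤ δ ^ j) :
    ∀ j, 1 ≤ j → j ≤ k → ∀ i,
      |(H ^ j).mulVec f i - (∑ x, s x * f x) / n * s i| ≤ 8 * δ * j := by
  have hn' : (0 : ℝ) < n := by exact_mod_cast hn
  have hs1 : ∀ i, |s i| = 1 := fun i => (pow_eq_one_iff_of_nonneg (abs_nonneg _)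
    two_ne_zero).1 (by rw [sq_abs, hs])
  set a : ℕ → ℝ := fun l => (∑ x, s x * (H ^ l).mulVec f x) / n with ha
  have ha0 : a 0 = (∑ x, s x * f x) / n := by simp [ha]
  rw [← ha0]
  have hf1 : ∀ i, |f i| ≤ 1 := fun i => by simpa using hf 0 (Nat.zero_le _) i
  have hmean : ∀ {v : Fin n → ℝ} {F : ℝ}, (∀ i, |v i| ≤ F) → |(∑ x, s x * v x) / n| ≤ F :=
    fun {v F} h => abs_mean_le hn fun i => by rw [abs_mul, hs1, one_mul]; exact h i
  have ha01 : |a 0| ≤ 1 := ha0 ▸ hmean hf1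
  have hexp : ∀ j, 1 ≤ j → j ≤ k → (∀ l < j, ∀ i, |(H ^ l).mulVec f i| ≤ 2) →
      ∀ i, |(H ^ j).mulVec f i - a (j - 1) * s i| ≤ 8 * δ := by
    intro j hj1 hjk hF i
    obtain ⟨j, rfl⟩ := Nat.exists_eq_add_of_le' hj1
    have hδ' : δ ≤ 1 / 100 := by
      have : (1 : ℝ) ≤ k := by exact_mod_cast hj1.trans hjk
      nlinarith
    have haa : ∀ l < j + 1, |a l| ≤ 2 := fun l hl => hmean (hF l hl)
    have hbb : ∀ l < j + 1, |β * (∑ x, (H ^ l).mulVec f x) / n| ≤ 2 * δ := fun l hl => by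
      rw [mul_div_assoc, abs_mul, mul_comm 2]
      exact mul_le_mul hβ (abs_mean_le hn (hF l hl)) (abs_nonneg _) hδ0
    rw [pow_mulVec_eq_of_rank_two_perturbation hH, Finset.sum_range_succ]
    simp only [Nat.add_sub_cancel, Nat.sub_self, pow_zero, Matrix.one_mulVec, mul_one]
    have h1 : |∑ l ∈ Finset.range j,
        ((∑ x, s x * (H ^ l).mulVec f x) / n * (B ^ (j - l)).mulVec s i +
        β * (∑ x, (H ^ l).mulVec f x) / n * (B ^ (j - l)).mulVec (fun _ => 1) i)| ≤
        (2 + 2 * δ) * (δ * 2) := by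
      calc _ ≤ ∑ l ∈ Finset.range j, (2 + 2 * δ) * (δ * δ ^ (j - 1 - l)) := by
            refine (Finset.abs_sum_le_sum_abs _ _).trans (Finset.sum_le_sum fun l hl => ?_)
            have hl := Finset.mem_range.1 hl
            rw [← pow_succ', show j - 1 - l + 1 = j - l by omega, add_mul]
            refine (abs_add_le _ _).trans ?_
            rw [abs_mul, abs_mul]
            exact add_le_add
              (mul_le_mul (haa l (by omega)) (hBs _ (by omega) i) (abs_nonneg _) (by norm_num))
              (mul_le_mul (hbb l (by omega)) (hB1 _ (by omega) i) (abs_nonneg _) (by positivity))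
        _ = (2 + 2 * δ) * (δ * ∑ l ∈ Finset.range j, δ ^ l) := by
            rw [← Finset.mul_sum, ← Finset.mul_sum, Finset.sum_range_reflect (fun l => δ ^ l) j]
        _ ≤ _ := by
            gcongr
            exact sum_range_pow_le hδ0 (by linarith) j
    have h2 := hf (j + 1) hjk i
    have h3 : δ ^ (j + 1) ≤ δ := by
      rw [pow_succ]
      exact mul_le_of_le_one_left hδ0 (pow_le_one₀ hδ0 (by linarith))
    have h4 := hbb j (by omega)
    simp only [ha]
    rw [abs_le] at h1 h2 h4 ⊢
    constructor <;> nlinarith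
  have main : ∀ j, j ≤ k → |a j - a 0| ≤ 8 * δ * j ∧ (∀ i, |(H ^ j).mulVec f i| ≤ 2) ∧
      (1 ≤ j → ∀ i, |(H ^ j).mulVec f i - a 0 * s i| ≤ 8 * δ * j) := by
    intro j
    induction j using Nat.strong_induction_on with
    | _ j ih =>
      intro hjk
      rcases Nat.eq_zero_or_pos j with rfl | hj
      · refine ⟨by simp, fun i => ?_, by simp⟩
        simpa using (hf1 i).trans (by norm_num)
      have h1 := hexp j hj hjk fun l hl => (ih l hl (by omega)).2.1
      have h2 := (ih (j - 1) (by omega) (by omega)).1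
      have hcast : ((j - 1 : ℕ) : ℝ) = j - 1 := by rw [Nat.cast_sub hj]; simp
      rw [hcast] at h2
      have hjδ : 8 * δ * j ≤ 8 / 100 := by
        have : (j : ℝ) ≤ k := by exact_mod_cast hjk
        nlinarith
      have h3 : |a j - a (j - 1)| ≤ 8 * δ := by
        have h4 := hmean (v := fun i => (H ^ j).mulVec f i - a (j - 1) * s i) h1
        convert h4 using 2
        have h5 : ∀ x, s x * ((H ^ j).mulVec f x - a (j - 1) * s x) =
            s x * (H ^ j).mulVec f x - a (j - 1) := fun x => by
          linear_combination (-a (j - 1)) * hs x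
        simp_rw [h5]
        rw [Finset.sum_sub_distrib]
        simp only [ha, Finset.sum_const, Finset.card_univ, Fintype.card_fin, nsmul_eq_mul]
        field_simp
      have h6 : ∀ i, |(H ^ j).mulVec f i - a 0 * s i| ≤ 8 * δ * j := fun i => by
        have h7 : |(a (j - 1) - a 0) * s i| ≤ 8 * δ * (j - 1) := by
          rw [abs_mul, hs1, mul_one]; exact h2
        have h8 := h1 i
        rw [abs_le] at h7 h8 ⊢
        constructor <;> nlinarith
      refine ⟨?_, fun i => ?_, fun _ => h6⟩
      · rw [abs_le] at h2 h3 ⊢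
        constructor <;> nlinarith
      · have h7 : |a 0 * s i| ≤ 1 := by rw [abs_mul, hs1, mul_one]; exact ha01
        have h8 := h6 i
        rw [abs_le] at h7 h8 ⊢
        constructor <;> linarith
  exact fun j hj hjk => (main j hjk).2.2 hj

lemma abs_pow_mulVec_le_two (hn : 0 < n) (hs : ∀ i, s i ^ 2 = 1)
    (hδ0 : 0 ≤ δ) (hδ : k * δ ≤ 1 / 100) (hβ : |β| ≤ δ)
    (hH : ∀ i j, H i j = B i j + s i * s j / n + β / n)
    (hB1 : ∀ j ≤ k, ∀ i, |(B ^ j).mulVec (fun _ => 1) i| ≤ δ ^ j)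
    (hBs : ∀ j ≤ k, ∀ i, |(B ^ j).mulVec s i| ≤ δ ^ j)
    {f : Fin n → ℝ} (hf : ∀ j ≤ k, ∀ i, |(B ^ j).mulVec f i| ≤ δ ^ j)
    {j : ℕ} (hj : j ≤ k) (i : Fin n) : |(H ^ j).mulVec f i| ≤ 2 := by
  have hf1 : ∀ i, |f i| ≤ 1 := fun i => by simpa using hf 0 (Nat.zero_le _) i
  rcases Nat.eq_zero_or_pos j with rfl | hj0
  · simpa using (hf1 i).trans (by norm_num)
  have hs1 : ∀ i, |s i| = 1 := fun i => (pow_eq_one_iff_of_nonneg (abs_nonneg _)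
    two_ne_zero).1 (by rw [sq_abs, hs])
  have h1 := abs_pow_mulVec_sub_le hn hs hδ0 hδ hβ hH hB1 hBs hf j hj0 hj i
  have h2 : |(∑ x, s x * f x) / n * s i| ≤ 1 := by
    rw [abs_mul, hs1, mul_one]
    exact abs_mean_le hn fun i => by rw [abs_mul, hs1, one_mul]; exact hf1 i
  have h3 : 8 * δ * j ≤ 8 / 100 := by
    have : (j : ℝ) ≤ k := by exact_mod_cast hj
    nlinarith
  rw [abs_le] at h1 h2 ⊢
  constructor <;> linarith

/-- The rows of a power of the perturbed matrix are short. -/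
lemma sum_row_pow_sq_le (hn : 0 < n) (hs : ∀ i, s i ^ 2 = 1) (hk : 0 < k)
    (hδ0 : 0 ≤ δ) (hδ : k * δ ≤ 1 / 100) (hβ : |β| ≤ δ) (hBt : Bᵀ = B)
    (hH : ∀ i j, H i j = B i j + s i * s j / n + β / n)
    (hB1 : ∀ j ≤ k, ∀ i, |(B ^ j).mulVec (fun _ => 1) i| ≤ δ ^ j)
    (hBs : ∀ j ≤ k, ∀ i, |(B ^ j).mulVec s i| ≤ δ ^ j) (i : Fin n) :
    ‖WithLp.toLp 2 ((H ^ k) i)‖ ≤ specNorm B ^ k + 8 / √n := by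
  have hn' : (0 : ℝ) < n := by exact_mod_cast hn
  have hδ' : δ ≤ 1 / 100 := by
    have : (1 : ℝ) ≤ k := by exact_mod_cast hk
    nlinarith
  have hHt : Hᵀ = H := by
    ext a b
    have h1 : B b a = B a b := congrFun (congrFun hBt a) b
    rw [Matrix.transpose_apply, hH, hH, h1, mul_comm (s a)]
  have hcol : ∀ (M : Matrix (Fin n) (Fin n) ℝ), Mᵀ = M → ∀ (l : ℕ) (x : Fin n),
      (M ^ l).mulVec (Pi.single x 1) = (M ^ l) x := by
    intro M hM l x
    rw [Matrix.mulVec_single_one]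
    ext y
    rw [Matrix.col_apply, ← Matrix.transpose_apply (M ^ l), Matrix.transpose_pow, hM]
  have hentry : ∀ x, |(H ^ k) i x - (B ^ k) i x| ≤ 8 / n := by
    intro x
    have h1 := pow_mulVec_eq_of_rank_two_perturbation hH (Pi.single x 1) k i
    have h2 : ∀ (l : ℕ) (f : Fin n → ℝ),
        ∑ y, f y * (H ^ l).mulVec (Pi.single x 1) y = (H ^ l).mulVec f x := by
      intro l f
      rw [hcol H hHt, Matrix.mulVec, dotProduct]
      exact Finset.sum_congr rfl fun y _ => mul_comm _ _
    have h3 : ∀ l : ℕ, ∑ y, (H ^ l).mulVec (Pi.single x 1) y = (H ^ l).mulVec (fun _ => 1) x := by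
      intro l
      simpa using h2 l fun _ => 1
    simp only [h2, h3] at h1
    rw [Matrix.mulVec_single_one, Matrix.mulVec_single_one, Matrix.col_apply,
      Matrix.col_apply] at h1
    rw [h1, add_sub_cancel_left]
    calc _ ≤ ∑ l ∈ Finset.range k, (2 + 2 * δ) / n * δ ^ (k - 1 - l) := by
          refine (Finset.abs_sum_le_sum_abs _ _).trans (Finset.sum_le_sum fun l hl => ?_)
          have hl := Finset.mem_range.1 hl
          have hFs := abs_pow_mulVec_le_two hn hs hδ0 hδ hβ hH hB1 hBs hBs hl.le x
          have hF1 := abs_pow_mulVec_le_two hn hs hδ0 hδ hβ hH hB1 hBs hB1 hl.le x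
          rw [add_div, add_mul]
          refine (abs_add_le _ _).trans ?_
          rw [abs_mul, abs_mul, abs_div, abs_div, abs_mul, Nat.abs_cast, mul_comm |β|]
          exact add_le_add
            (mul_le_mul (by gcongr) (hBs _ (by omega) i) (abs_nonneg _) (by positivity))
            (mul_le_mul (by gcongr) (hB1 _ (by omega) i) (abs_nonneg _) (by positivity))
      _ = (2 + 2 * δ) / n * ∑ l ∈ Finset.range k, δ ^ l := by
          rw [← Finset.mul_sum, Finset.sum_range_reflect (fun l => δ ^ l) k]
      _ ≤ (2 + 2) / n * 2 := by
          gcongr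
          · linarith
          · exact sum_range_pow_le hδ0 (by linarith) k
      _ = 8 / n := by ring
  have hB : ‖WithLp.toLp 2 ((B ^ k) i)‖ ≤ specNorm B ^ k := by
    rw [← hcol B hBt]
    refine (norm_mulVec_le _ _).trans ?_
    have : ‖WithLp.toLp 2 (Pi.single i 1 : Fin n → ℝ)‖ = 1 := by
      simp
    rw [this, mul_one]
    exact specNorm_pow_le B hk
  have hd : ‖WithLp.toLp 2 ((H ^ k) i - (B ^ k) i)‖ ≤ 8 / √n := by
    refine abs_le_of_sq_le_sq' ?_ (by positivity) |>.2
    rw [norm_toLp_sq, div_pow, Real.sq_sqrt hn'.le]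
    calc _ ≤ ∑ _x : Fin n, (8 / (n : ℝ)) ^ 2 :=
          Finset.sum_le_sum fun x _ => sq_le_sq' (abs_le.1 (hentry x)).1 (abs_le.1 (hentry x)).2
      _ = _ := by
          simp
          field_simp
  have := norm_add_le (WithLp.toLp 2 ((B ^ k) i)) (WithLp.toLp 2 ((H ^ k) i - (B ^ k) i))
  rw [← WithLp.toLp_add, add_sub_cancel] at this
  linarith

end

/-- The `±1` class labels. -/
def blockSign (n : ℕ) (i : Fin n) : ℝ := if (i : ℕ) < n / 2 then 1 else -1

lemma sig_eq_mul_blockSign (n : ℕ) (i : Fin n) : sig n i = (√n)⁻¹ * blockSign n i := by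
  unfold sig blockSign
  split_ifs <;> simp

lemma blockSign_sq {n : ℕ} (i : Fin n) : blockSign n i ^ 2 = 1 := by
  unfold blockSign
  split_ifs <;> norm_num

lemma sum_blockSign {n : ℕ} (hn : Even n) : ∑ i, blockSign n i = 0 := by
  obtain ⟨m, rfl⟩ := hn
  rw [Fin.sum_univ_add]
  have h : (m + m) / 2 = m := by omega
  simp [blockSign, h]

lemma edgeProb_eq {n : ℕ} (p q : ℝ) (i j : Fin n) :
    edgeProb p q i j = (p + q) / 2 + (p - q) / 2 * (blockSign n i * blockSign n j) := by
  unfold edgeProb blockSign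
  by_cases h1 : (i : ℕ) < n / 2 <;> by_cases h2 : (j : ℕ) < n / 2 <;> simp [h1, h2] <;> ring

lemma adjM_eq {n : ℕ} (p q : ℝ) (ω : Fin n → Fin n → Bool) (i j : Fin n) :
    adjM ω i j = (noise p q ω - p • (1 : Matrix (Fin n) (Fin n) ℝ)) i j + edgeProb p q i j := by
  by_cases h : i = j
  · subst h
    simp [adjM, noise, edgeProb]
  · rw [Matrix.sub_apply, Matrix.smul_apply, Matrix.one_apply_ne h]
    simp only [adjM, noise, Matrix.of_apply, if_neg h, edgeProb_min_max]
    rcases le_total i j with h1 | h1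
    · simp [h1]
    · have : ¬ i ≤ j := fun h2 => h (le_antisymm h2 h1)
      simp [h1, this]

lemma abs_noise_sub_pow_mulVec_le {n : ℕ} {W : Matrix (Fin n) (Fin n) ℝ} {f : Fin n → ℝ}
    {T p : ℝ} {k : ℕ} (_hT : 0 ≤ T) (hp : 0 ≤ p)
    (h : ∀ j ≤ k, ∀ i, |(W ^ j).mulVec f i| ≤ T ^ j) {j : ℕ} (hj : j ≤ k) (i : Fin n) :
    |((W - p • (1 : Matrix (Fin n) (Fin n) ℝ)) ^ j).mulVec f i| ≤ (T + p) ^ j := by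
  have key : ∀ j a, a + j ≤ k → ∀ i, |(W ^ a).mulVec
      (((W - p • (1 : Matrix (Fin n) (Fin n) ℝ)) ^ j).mulVec f) i| ≤ T ^ a * (T + p) ^ j := by
    intro j
    induction j with
    | zero => intro a ha i; simpa using h a ha i
    | succ j ih =>
      intro a ha i
      rw [pow_succ', Matrix.mulVec_mulVec, ← mul_assoc, mul_sub, ← pow_succ, mul_smul_comm,
        mul_one, sub_mul, smul_mul_assoc, Matrix.sub_mulVec, Matrix.smul_mulVec,
        ← Matrix.mulVec_mulVec, ← Matrix.mulVec_mulVec, Pi.sub_apply, Pi.smul_apply, smul_eq_mul]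
      refine (abs_sub _ _).trans ?_
      rw [abs_mul, abs_of_nonneg hp]
      calc _ ≤ T ^ (a + 1) * (T + p) ^ j + p * (T ^ a * (T + p) ^ j) := by
            gcongr
            · exact ih (a + 1) (by omega) i
            · exact ih a (by omega) i
        _ = _ := by ring
  simpa using key j 0 (by omega) i

/-- On a good realisation of the graph, powers of the rescaled corrected convolution keep the
class labels and have short rows. -/
lemma convolution_pow_of_good {n k : ℕ} {p q T T' : ℝ} {ω : Fin n → Fin n → Bool} (hn : 0 < n)
    (hne : Even n) (hq : 0 ≤ q) (hqp : q < p) (hp : p ≤ 1) (hk : 0 < k) (hT : 1 ≤ T)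
    (hδ : k * (2 * T / ((p - q) * n / 2)) ≤ 1 / 100)
    (h1 : ∀ j, 1 ≤ j → j ≤ k → ∀ i, |(noise p q ω ^ j).mulVec (fun _ => 1) i| ≤ T ^ j)
    (hs : ∀ j, 1 ≤ j → j ≤ k → ∀ i, |(noise p q ω ^ j).mulVec (blockSign n) i| ≤ T ^ j)
    (hop : specNorm (noise p q ω) ≤ T') (i : Fin n) :
    |((((p - q) * n / (2 * avgDeg ω))⁻¹ • tildeA ω) ^ k).mulVec (blockSign n) i -
        blockSign n i| ≤ 8 / 100 ∧
      ‖WithLp.toLp 2 (((((p - q) * n / (2 * avgDeg ω))⁻¹ • tildeA ω) ^ k) i)‖ ≤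
        ((T' + 1) / ((p - q) * n / 2)) ^ k + 8 / √n := by
  have hn' : (0 : ℝ) < n := by exact_mod_cast hn
  have hp0 : 0 ≤ p := hq.trans hqp.le
  have hT0 : 0 ≤ T := zero_le_one.trans hT
  have hpq : 0 < p - q := sub_pos.2 hqp
  obtain ⟨Q, hQ⟩ : ∃ Q, Q = (p - q) * n / 2 := ⟨_, rfl⟩
  have hQ0 : 0 < Q := hQ ▸ by positivity
  set M := noise p q ω - p • (1 : Matrix (Fin n) (Fin n) ℝ) with hM
  set B := Q⁻¹ • M with hB
  set δ : ℝ := 2 * T / Q with hδdef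
  have hδ0 : 0 ≤ δ := by positivity
  have hk1 : (1 : ℝ) ≤ k := by exact_mod_cast hk
  rw [← hQ, ← hδdef] at hδ
  have hδ1 : δ ≤ 1 / 100 := by nlinarith
  have hMf : ∀ f : Fin n → ℝ, (∀ i, |f i| ≤ 1) →
      (∀ j, 1 ≤ j → j ≤ k → ∀ i, |(noise p q ω ^ j).mulVec f i| ≤ T ^ j) →
      ∀ j ≤ k, ∀ i, |(M ^ j).mulVec f i| ≤ (2 * T) ^ j := by
    intro f hf1 hf j hj i
    refine (abs_noise_sub_pow_mulVec_le hT0 hp0 (k := k) (fun j hj i => ?_) hj i).trans ?_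
    · rcases Nat.eq_zero_or_pos j with rfl | h
      · simpa using hf1 i
      · exact hf j h hj i
    · gcongr
      linarith
  have hBf : ∀ f : Fin n → ℝ, (∀ j ≤ k, ∀ i, |(M ^ j).mulVec f i| ≤ (2 * T) ^ j) →
      ∀ j ≤ k, ∀ i, |(B ^ j).mulVec f i| ≤ δ ^ j := by
    intro f hf j hj i
    rw [hB, smul_pow, Matrix.smul_mulVec, Pi.smul_apply, smul_eq_mul, abs_mul, hδdef, div_eq_inv_mul,
      mul_pow, abs_of_nonneg (by positivity)]
    gcongr
    exact hf j hj i
  have hM1 := hMf (fun _ => 1) (by simp) h1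
  have hMs := hMf (blockSign n) (fun i => by unfold blockSign; split_ifs <;> simp) hs
  have havg : avgDeg ω = (∑ i, M.mulVec (fun _ => 1) i) / n + n * (p + q) / 2 := by
    have : ∑ i, ∑ j, adjM ω i j = ∑ i, M.mulVec (fun _ => 1) i + n * (n * (p + q) / 2) := by
      simp only [adjM_eq p q ω, edgeProb_eq, Finset.sum_add_distrib, ← Finset.mul_sum,
        sum_blockSign hne, mul_zero, Finset.sum_const, Finset.card_univ, Fintype.card_fin,
        nsmul_eq_mul, Matrix.mulVec, dotProduct, mul_one, ← hM]
      ring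
    rw [avgDeg, this]
    field_simp
  have hmean : |(∑ i, M.mulVec (fun _ => 1) i) / n| ≤ 2 * T :=
    abs_mean_le hn fun i => by simpa using hM1 1 hk i
  have h2T : 2 * T = δ * Q := by rw [hδdef]; field_simp
  have hd0 : 0 < avgDeg ω := by
    have h3 := (abs_le.1 hmean).1
    have h4 : Q ≤ n * (p + q) / 2 := by rw [hQ]; nlinarith
    rw [havg]
    nlinarith
  set d := avgDeg ω with hd
  set β : ℝ := (n * (p + q) / 2 - d) / Q with hβdef
  have hβ : |β| ≤ δ := by
    rw [hβdef, abs_div, abs_of_pos hQ0, div_le_iff₀ hQ0, ← h2T, havg, sub_add_cancel_right, abs_neg]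
    exact hmean
  set H := ((p - q) * n / (2 * d))⁻¹ • tildeA ω with hHdef
  have hH : ∀ i j, H i j = B i j + blockSign n i * blockSign n j / n + β / n := by
    intro i j
    have h5 : (p - q) * n / (2 * d) = Q / d := by rw [hQ]; field_simp
    have h6 : H i j = (Q / d)⁻¹ * (d⁻¹ * adjM ω i j - (n : ℝ)⁻¹ * 1) := by
      rw [hHdef, h5]; simp [tildeA, ← hd]
    have h7 : B i j = Q⁻¹ * M i j := by rw [hB]; simp
    have h8 : p - q = 2 * Q / n := by rw [hQ]; field_simp
    rw [h6, h7, adjM_eq p q ω, edgeProb_eq, h8, ← hM, hβdef]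
    field_simp
    ring
  have hMt : Bᵀ = B := by
    rw [hB, hM, Matrix.transpose_smul, Matrix.transpose_sub, Matrix.transpose_smul, noise_transpose,
      Matrix.transpose_one]
  have hsB : specNorm B ≤ (T' + 1) / Q := by
    have h9 : specNorm M ≤ T' + 1 := by
      rw [specNorm, hM, map_sub, map_smul, map_one]
      refine (norm_sub_le _ _).trans (add_le_add hop ?_)
      rw [norm_smul, Real.norm_of_nonneg hp0]
      exact mul_le_one₀ hp (norm_nonneg _) ContinuousLinearMap.norm_id_le
    rw [specNorm, hB, map_smul, norm_smul, Real.norm_of_nonneg (by positivity), div_eq_inv_mul]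
    gcongr
    exact h9
  have hB1 := hBf _ hM1
  have hBs := hBf _ hMs
  refine ⟨?_, ?_⟩
  · have h := abs_pow_mulVec_sub_le hn blockSign_sq hδ0 hδ hβ hH hB1 hBs hBs k hk le_rfl i
    have h10 : (∑ x, blockSign n x * blockSign n x) / n = 1 := by
      simp_rw [← sq, blockSign_sq]
      simp [hn'.ne']
    rw [h10, one_mul] at h
    exact h.trans (by nlinarith)
  · refine (sum_row_pow_sq_le hn blockSign_sq hk hδ0 hδ hβ hMt hH hB1 hBs i).trans ?_
    rw [← hQ]
    gcongr
    exact specNorm_nonneg _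

/-- The constant in the entrywise bound on powers of the noise matrix. -/
noncomputable def entryConst (Ck : ℝ) : ℝ := √(4 * Real.exp 4 * (3 + 2 * Ck))

/-- The constant in the spectral bound on the noise matrix. -/
noncomputable def normConst : ℝ := √(4 * Real.exp 2 * triConst)

/-- The graph realisations on which the noise is well behaved. -/
def GoodGraph (n k : ℕ) (p q T T' : ℝ) (ω : Fin n → Fin n → Bool) : Prop :=
  (∀ j, 1 ≤ j → j ≤ k → ∀ i, |(noise p q ω ^ j).mulVec (fun _ => 1) i| ≤ T ^ j) ∧
  (∀ j, 1 ≤ j → j ≤ k → ∀ i, |(noise p q ω ^ j).mulVec (blockSign n) i| ≤ T ^ j) ∧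
  specNorm (noise p q ω) ≤ T'

lemma triConst_pos : 0 < triConst := by unfold triConst; positivity

section

variable {n k : ℕ} {p q Ck : ℝ}

lemma noise_pow_mulVec_tail_le (hCk : 0 < Ck) (hn : 0 < n) (hq : 0 ≤ q) (hqp : q ≤ p)
    (hp : p ≤ 1) (hL1 : 1 ≤ Real.log n) (hL2 : 3 + 2 * Ck ≤ Real.log n ^ 2)
    (hk : (k : ℝ) ≤ Ck * Real.log n) (hnp : Real.log n ^ 3 ≤ n * p)
    {f : Fin n → ℝ} (hf : ∀ i, |f i| ≤ 1) {j : ℕ} (hj : 1 ≤ j) (hjk : j ≤ k) (i : Fin n) :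
    (sbm n p q).real {ω | (entryConst Ck * √(n * p * Real.log n)) ^ j ≤
      |(noise p q ω ^ j).mulVec f i|} ≤ ((n : ℝ) ^ 4)⁻¹ := by
  have hn' : (0 : ℝ) < n := by exact_mod_cast hn
  set L := Real.log n with hL
  have hL0 : 0 < L := by linarith
  have hj' : (1 : ℝ) ≤ j := by exact_mod_cast hj
  have hjk' : (j : ℝ) ≤ Ck * L := (by exact_mod_cast hjk : (j : ℝ) ≤ k).trans hk
  have hnp0 : 0 < n * p := lt_of_lt_of_le (by positivity) hnp
  have hp0 : 0 < p := (pos_iff_pos_of_mul_pos hnp0).1 hn'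
  set M := ⌈L / j⌉₊ with hM
  have hH1 : L ≤ (M * j : ℕ) := by
    have h := Nat.le_ceil (L / j)
    rw [div_le_iff₀ (by linarith)] at h
    push_cast
    exact h
  have hH2 : ((M * j : ℕ) : ℝ) ≤ (1 + Ck) * L := by
    have h := (Nat.ceil_lt_add_one (a := L / j) (by positivity)).le
    rw [← hM] at h
    push_cast
    calc (M : ℝ) * j ≤ (L / j + 1) * j := by gcongr
      _ = L + j := by field_simp
      _ ≤ _ := by linarith
  have hH3 : 2 * ((M * j : ℕ) : ℝ) + 1 ≤ (3 + 2 * Ck) * L := by nlinarith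
  have hH4 : 2 * ((M * j : ℕ) : ℝ) + 1 ≤ n * p := by
    refine hH3.trans (le_trans ?_ hnp)
    calc (3 + 2 * Ck) * L ≤ L ^ 2 * L := by gcongr
      _ = _ := by ring
  have hC0 : 0 < 4 * Real.exp 4 * (3 + 2 * Ck) := by positivity
  have hT : 0 < entryConst Ck * √(n * p * L) :=
    mul_pos (Real.sqrt_pos.2 hC0) (Real.sqrt_pos.2 (by positivity))
  refine (noise_pow_mulVec_tail hq hqp hp hp0 hf i j M hH4 hT).trans ?_
  have hbase : 4 * (n * p) * (2 * ((M * j : ℕ) : ℝ) + 1) / (entryConst Ck * √(n * p * L)) ^ 2 ≤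
      Real.exp (-4) := by
    rw [mul_pow, entryConst, Real.sq_sqrt hC0.le, Real.sq_sqrt (by positivity), Real.exp_neg,
      div_le_iff₀ (by positivity)]
    calc _ ≤ 4 * (n * p) * ((3 + 2 * Ck) * L) := by gcongr
      _ = _ := by field_simp
  calc _ ≤ Real.exp (-4) ^ (M * j) := by gcongr
    _ = Real.exp (-(4 * (M * j : ℕ))) := by rw [← Real.exp_nat_mul]; ring_nf
    _ ≤ Real.exp (-(4 * L)) := by gcongr
    _ = _ := by
        rw [Real.exp_neg, show (4 : ℝ) * L = (4 : ℕ) * L by norm_num, Real.exp_nat_mul, hL,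
          Real.exp_log hn']

lemma noise_specNorm_tail_le (hn : 0 < n) (hq : 0 ≤ q) (hqp : q ≤ p)
    (hp : p ≤ 1) (hL1 : 1 ≤ Real.log n) (hL2 : 3 ≤ Real.log n ^ 2)
    (hnp : Real.log n ^ 3 ≤ n * p) :
    (sbm n p q).real {ω | normConst * √(n * p) ≤ specNorm (noise p q ω)} ≤ ((n : ℝ) ^ 3)⁻¹ := by
  have hn' : (0 : ℝ) < n := by exact_mod_cast hn
  set L := Real.log n with hL
  have hL0 : 0 < L := by linarith
  have hnp2 : 2 * L ≤ n * p := by nlinarith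
  have hnp0 : 0 < n * p := lt_of_lt_of_le (by positivity) hnp
  have htri := triConst_pos
  set N := ⌈n * p⌉₊ with hN
  have hN1 : n * p ≤ N := Nat.le_ceil _
  have hN2 : (N : ℝ) ≤ 2 * (n * p) := by
    have := (Nat.ceil_lt_add_one hnp0.le).le
    rw [← hN] at this
    linarith
  have hN3 : 1 < N := by
    have : (1 : ℝ) < N := by linarith
    exact_mod_cast this
  set l := Nat.clog 2 N with hl
  have hl1 : N ≤ 2 ^ l := Nat.le_pow_clog (by norm_num) N
  have hl2 : (2 ^ l : ℕ) ≤ 2 * N := by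
    have h := Nat.pow_pred_clog_lt_self (b := 2) (by norm_num) hN3
    have h0 : 0 < l := Nat.clog_pos (by norm_num) hN3
    rw [← hl] at h
    have : 2 ^ l = 2 * 2 ^ l.pred := by
      rw [← pow_succ']; congr 1; exact (Nat.succ_pred_eq_of_pos h0).symm
    omega
  have hl2' : ((2 ^ l : ℕ) : ℝ) ≤ 4 * (n * p) := by
    have : ((2 ^ l : ℕ) : ℝ) ≤ 2 * N := by exact_mod_cast hl2
    linarith
  have hl1' : n * p ≤ (2 ^ l : ℕ) := hN1.trans (by exact_mod_cast hl1)
  have hC0 : 0 < 4 * Real.exp 2 * triConst := by positivity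
  have hT : 0 < normConst * √(n * p) := mul_pos (Real.sqrt_pos.2 hC0) (Real.sqrt_pos.2 hnp0)
  refine (noise_specNorm_tail (l := l) (r := N + 2 ^ l) hq hqp hp (by push_cast; gcongr)
    (by omega) hT).trans ?_
  have hbase : triConst * (2 ^ l : ℕ) / (normConst * √(n * p)) ^ 2 ≤ Real.exp (-2) := by
    rw [mul_pow, normConst, Real.sq_sqrt hC0.le, Real.sq_sqrt hnp0.le, Real.exp_neg,
      div_le_iff₀ (by positivity)]
    calc _ ≤ triConst * (4 * (n * p)) := by gcongr
      _ = _ := by field_simp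
  calc _ ≤ n * Real.exp (-2) ^ 2 ^ l := by gcongr
    _ = n * Real.exp (-(2 * (2 ^ l : ℕ))) := by rw [← Real.exp_nat_mul]; push_cast; ring_nf
    _ ≤ n * Real.exp (-(4 * L)) := by
        refine mul_le_mul_of_nonneg_left (Real.exp_le_exp.2 ?_) hn'.le
        linarith
    _ = _ := by
        rw [Real.exp_neg, show (4 : ℝ) * L = (4 : ℕ) * L by norm_num, Real.exp_nat_mul, hL,
          Real.exp_log hn']
        field_simp

/-- Most graphs are good. -/
lemma sbm_real_not_goodGraph_le (hCk : 0 < Ck) (hn : 0 < n) (hq : 0 ≤ q) (hqp : q ≤ p)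
    (hp : p ≤ 1) (hL1 : 1 ≤ Real.log n) (hL2 : 3 + 2 * Ck ≤ Real.log n ^ 2)
    (hk : (k : ℝ) ≤ Ck * Real.log n) (hnp : Real.log n ^ 3 ≤ n * p) :
    (sbm n p q).real {ω | ¬ GoodGraph n k p q (entryConst Ck * √(n * p * Real.log n))
      (normConst * √(n * p)) ω} ≤ (2 * Ck + 1) / n ^ 2 := by
  have hn' : (0 : ℝ) < n := by exact_mod_cast hn
  have hn1 : (1 : ℝ) ≤ n := by exact_mod_cast hn
  have := isProbabilityMeasure_sbm (n := n) hq hqp hp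
  set T := entryConst Ck * √(n * p * Real.log n)
  set T' := normConst * √(n * p)
  have hsub : {ω : Fin n → Fin n → Bool | ¬ GoodGraph n k p q T T' ω} ⊆
      (⋃ j ∈ Finset.Icc 1 k, ⋃ i : Fin n,
        ({ω | T ^ j ≤ |(noise p q ω ^ j).mulVec (fun _ => 1) i|} ∪
        {ω | T ^ j ≤ |(noise p q ω ^ j).mulVec (blockSign n) i|})) ∪
      {ω | T' ≤ specNorm (noise p q ω)} := by
    intro ω hω
    by_contra hcon
    simp only [Set.mem_union, Set.mem_iUnion, Set.mem_ofPred_eq, Finset.mem_Icc, not_or,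
      not_exists, not_le] at hcon
    exact hω ⟨fun j hj hjk i => (hcon.1 j ⟨hj, hjk⟩ i).1.le,
      fun j hj hjk i => (hcon.1 j ⟨hj, hjk⟩ i).2.le, hcon.2.le⟩
  refine (measureReal_mono hsub (by finiteness)).trans ((measureReal_union_le _ _).trans ?_)
  have h1 : (sbm n p q).real (⋃ j ∈ Finset.Icc 1 k, ⋃ i : Fin n,
        ({ω | T ^ j ≤ |(noise p q ω ^ j).mulVec (fun _ => 1) i|} ∪
        {ω | T ^ j ≤ |(noise p q ω ^ j).mulVec (blockSign n) i|})) ≤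
      ∑ _j ∈ Finset.Icc 1 k, ∑ _i : Fin n, 2 * ((n : ℝ) ^ 4)⁻¹ := by
    refine (measureReal_biUnion_finset_le _ _).trans (Finset.sum_le_sum fun j hj => ?_)
    have hj := Finset.mem_Icc.1 hj
    refine (measureReal_iUnion_fintype_le _).trans (Finset.sum_le_sum fun i _ => ?_)
    refine (measureReal_union_le _ _).trans ?_
    rw [two_mul]
    exact add_le_add
      (noise_pow_mulVec_tail_le hCk hn hq hqp hp hL1 hL2 hk hnp (by simp) hj.1 hj.2 i)
      (noise_pow_mulVec_tail_le hCk hn hq hqp hp hL1 hL2 hk hnp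
        (fun i => by unfold blockSign; split_ifs <;> simp) hj.1 hj.2 i)
  refine (add_le_add h1 (noise_specNorm_tail_le hn hq hqp hp hL1 (by linarith) hnp)).trans ?_
  simp only [Finset.sum_const, Finset.card_univ, Fintype.card_fin, Nat.card_Icc, nsmul_eq_mul,
    Nat.add_sub_cancel]
  have hLn : Real.log n ≤ n := (Real.log_le_sub_one_of_pos hn').trans (by linarith)
  have hkn : (k : ℝ) ≤ Ck * n := hk.trans (by gcongr)
  calc _ ≤ Ck * n * (n * (2 * ((n : ℝ) ^ 4)⁻¹)) + ((n : ℝ) ^ 2)⁻¹ := by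
        gcongr
        norm_num
    _ = _ := by field_simp

end

lemma isProbabilityMeasure_gauss1 (n : ℕ) (σ : ℝ) : IsProbabilityMeasure (gauss1 n σ) := by
  unfold gauss1
  infer_instance

lemma hasSubgaussianMGF_id_gaussianReal (v : NNReal) :
    HasSubgaussianMGF (fun x => x) v (gaussianReal 0 v) where
  integrable_exp_mul t := integrable_exp_mul_gaussianReal t
  mgf_le t := by rw [mgf_fun_id_gaussianReal]; simp

lemma hasSubgaussianMGF_sum_mul_gauss1 {n : ℕ} (σ : ℝ) (c : Fin n → ℝ) :
    HasSubgaussianMGF (fun g => ∑ l, c l * g l)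
      (Real.toNNReal (σ ^ 2 * ‖WithLp.toLp 2 c‖ ^ 2)) (gauss1 n σ) := by
  set v := Real.toNNReal (σ ^ 2) with hv
  have hind : iIndepFun (fun (l : Fin n) (g : Fin n → ℝ) => c l * g l) (gauss1 n σ) :=
    iIndepFun_pi (X := fun (l : Fin n) (x : ℝ) => c l * x) fun l => by fun_prop
  have hsub (l : Fin n) : HasSubgaussianMGF (fun g : Fin n → ℝ => c l * g l)
      (⟨c l ^ 2, sq_nonneg _⟩ * v) (gauss1 n σ) := by
    refine HasSubgaussianMGF.const_mul (X := fun g : Fin n → ℝ => g l) ?_ (c l)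
    refine HasSubgaussianMGF.of_map (X := fun x => x) (Y := fun g : Fin n → ℝ => g l)
      (measurable_pi_apply l).aemeasurable ?_
    have h := (measurePreserving_eval (fun _ : Fin n => gaussianReal 0 v) l).map_eq
    have h' : (gauss1 n σ).map (fun g => g l) = gaussianReal 0 v := h
    rw [h']
    exact hasSubgaussianMGF_id_gaussianReal v
  have h := HasSubgaussianMGF.sum_of_iIndepFun hind (s := Finset.univ) fun l _ => hsub l
  convert h using 1
  ext
  rw [Real.coe_toNNReal _ (by positivity), norm_toLp_sq, Finset.mul_sum]
  push_cast
  refine Finset.sum_congr rfl fun l _ => ?_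
  rw [mul_comm (σ ^ 2), ← Real.coe_toNNReal _ (sq_nonneg σ)]
  rfl

lemma gauss1_real_lt_abs_sum_le {n : ℕ} (hn : 0 < n) {σ : ℝ} (hσ : 0 < σ)
    (hL : 1 ≤ Real.log n) (c : Fin n → ℝ) :
    (gauss1 n σ).real {g | 3 * σ * ‖WithLp.toLp 2 c‖ * √(Real.log n) < |∑ l, c l * g l|} ≤
      2 * ((n : ℝ) ^ 3)⁻¹ := by
  have hn' : (0 : ℝ) < n := by exact_mod_cast hn
  have hprob := isProbabilityMeasure_gauss1 n σ
  set L := Real.log n with hLdef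
  set ε := 3 * σ * ‖WithLp.toLp 2 c‖ * √L with hε
  have hε0 : 0 ≤ ε := by positivity
  rcases eq_or_ne ‖WithLp.toLp 2 c‖ 0 with hc | hc
  · have hc0 : c = 0 := by simpa using hc
    have : {g : Fin n → ℝ | ε < |∑ l, c l * g l|} = ∅ := by
      ext g
      simp [hc0, hε0]
    rw [this]
    simp only [measureReal_empty]
    positivity
  have hX := hasSubgaussianMGF_sum_mul_gauss1 σ c
  have hexp : Real.exp (-ε ^ 2 / (2 * (Real.toNNReal (σ ^ 2 * ‖WithLp.toLp 2 c‖ ^ 2) : ℝ))) ≤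
      ((n : ℝ) ^ 3)⁻¹ := by
    rw [Real.coe_toNNReal _ (by positivity)]
    have : -ε ^ 2 / (2 * (σ ^ 2 * ‖WithLp.toLp 2 c‖ ^ 2)) = -(9 / 2 * L) := by
      rw [hε, mul_pow, Real.sq_sqrt (by linarith)]
      field_simp
      ring
    rw [this]
    calc _ ≤ Real.exp (-((3 : ℕ) * L)) := by
          refine Real.exp_le_exp.2 ?_
          push_cast
          linarith
      _ = _ := by rw [Real.exp_neg, Real.exp_nat_mul, hLdef, Real.exp_log hn']
  have hsub : {g : Fin n → ℝ | ε < |∑ l, c l * g l|} ⊆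
      {g | ε ≤ ∑ l, c l * g l} ∪ {g | ε ≤ (-fun g : Fin n → ℝ => ∑ l, c l * g l) g} := by
    intro g hg
    rcases lt_abs.1 (show ε < |∑ l, c l * g l| from hg) with h | h
    · exact Or.inl h.le
    · exact Or.inr h.le
  refine (measureReal_mono hsub (by finiteness)).trans ((measureReal_union_le _ _).trans ?_)
  rw [two_mul]
  exact add_le_add ((hX.measure_ge_le hε0).trans hexp) ((hX.neg.measure_ge_le hε0).trans hexp)

/-- The features are recovered when the rows of the propagation matrix `P` are short, `P` almost
preserves the signal and the noise behaves like a Gaussian along each row. -/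
lemma abs_mulVec_sub_sig_le {n : ℕ} (hn : 0 < n) {P : Matrix (Fin n) (Fin n) ℝ} {g : Fin n → ℝ}
    {σ L b : ℝ} (hL : 1 ≤ L) (hσ : 0 < σ) (hσL : σ ≤ 1 / 96 / √L) (i : Fin n)
    (hsign : |P.mulVec (blockSign n) i - blockSign n i| ≤ 8 / 100)
    (hrow : ‖WithLp.toLp 2 (P i)‖ ≤ b + 8 / √n)
    (hg : |∑ l, P i l * g l| ≤ 3 * σ * ‖WithLp.toLp 2 (P i)‖ * √L) :
    |P.mulVec (fun j => sig n j + g j) i - sig n i| ≤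
      1 / (2 * √n) + 3 * (b * σ * √L) := by
  have hn' : (0 : ℝ) < √n := Real.sqrt_pos.2 (by exact_mod_cast hn)
  have hL' : 0 < √L := Real.sqrt_pos.2 (by linarith)
  have hσL' : σ * √L ≤ 1 / 96 := (le_div_iff₀ hL').1 hσL
  have hsplit : P.mulVec (fun j => sig n j + g j) i - sig n i =
      (√n)⁻¹ * (P.mulVec (blockSign n) i - blockSign n i) + ∑ l, P i l * g l := by
    simp only [mulVec, dotProduct, mul_add, Finset.sum_add_distrib, sig_eq_mul_blockSign,
      mul_sub, Finset.mul_sum]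
    rw [Finset.sum_congr rfl fun l _ => mul_left_comm (P i l) (√(n : ℝ))⁻¹ (blockSign n l)]
    ring
  rw [hsplit]
  calc _ ≤ (√n)⁻¹ * (8 / 100) + 3 * σ * (b + 8 / √n) * √L := by
        refine (abs_add_le _ _).trans (add_le_add ?_ (hg.trans (by gcongr)))
        rw [abs_mul, abs_of_pos (inv_pos.2 hn')]
        gcongr
    _ = (8 / 100 + 24 * (σ * √L)) * (√n)⁻¹ + 3 * (b * σ * √L) := by ring
    _ ≤ (1 / 2) * (√n)⁻¹ + 3 * (b * σ * √L) := by
        gcongr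
        linarith
    _ = _ := by rw [one_div, one_div, mul_inv]

lemma one_le_entryConst {Ck : ℝ} (hCk : 0 < Ck) : 1 ≤ entryConst Ck := by
  refine Real.one_le_sqrt.2 ?_
  nlinarith [Real.one_le_exp (x := 4) (by norm_num)]

lemma normConst_pos : 0 < normConst := by
  have := triConst_pos
  unfold normConst
  positivity

/-- On a good graph the propagation matrix almost preserves signs and has short rows. -/
lemma GoodGraph.propagation {n k : ℕ} {p q Ck : ℝ} {ω : Fin n → Fin n → Bool}
    (hCk : 0 < Ck) (hn : 0 < n) (hne : Even n) (hq : 0 ≤ q) (hqp : q < p) (hp : p ≤ 1)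
    (hL : 1 ≤ Real.log n) (hnp : 1 ≤ n * p)
    (hγ : 400 * entryConst Ck * k * √(Real.log n / (n * p)) ≤ (p - q) / (p + q))
    (hω : GoodGraph n k p q (entryConst Ck * √(n * p * Real.log n))
      (normConst * √(n * p)) ω) (i : Fin n) :
    |((((p - q) * n / (2 * avgDeg ω))⁻¹ • tildeA ω) ^ k).mulVec (blockSign n) i -
        blockSign n i| ≤ 8 / 100 ∧
      ‖WithLp.toLp 2 (((((p - q) * n / (2 * avgDeg ω))⁻¹ • tildeA ω) ^ k) i)‖ ≤
        (2 * (normConst + 1) / ((p - q) / (p + q) * √(n * p))) ^ k + 8 / √n := by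
  have hn' : (0 : ℝ) < n := by exact_mod_cast hn
  have hp0 : 0 < p := hq.trans_lt hqp
  have hpq : 0 < p - q := sub_pos.2 hqp
  rcases Nat.eq_zero_or_pos k with rfl | hk
  · simp only [pow_zero, one_mulVec, sub_self, abs_zero]
    refine ⟨by norm_num, ?_⟩
    have h1 : ‖WithLp.toLp 2 ((1 : Matrix (Fin n) (Fin n) ℝ) i)‖ ^ 2 = 1 := by
      rw [norm_toLp_sq]
      simp [Matrix.one_apply]
    have h2 : ‖WithLp.toLp 2 ((1 : Matrix (Fin n) (Fin n) ℝ) i)‖ = 1 := by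
      nlinarith [norm_nonneg (WithLp.toLp 2 ((1 : Matrix (Fin n) (Fin n) ℝ) i))]
    rw [h2]
    linarith [show (0 : ℝ) ≤ 8 / √n by positivity]
  set L := Real.log n with hLdef
  set γ := (p - q) / (p + q) with hγdef
  have hγ0 : 0 < γ := by positivity
  have hE := one_le_entryConst hCk
  have hN := normConst_pos
  set s := √(n * p) with hs
  have hs1 : 1 ≤ s := Real.one_le_sqrt.2 hnp
  have hs2 : s ^ 2 = n * p := Real.sq_sqrt (by linarith)
  have hQ : γ * s ^ 2 / 2 ≤ (p - q) * n / 2 := by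
    rw [hs2, hγdef, div_mul_eq_mul_div]
    gcongr ?_ / 2
    rw [div_le_iff₀ (by positivity)]
    nlinarith [mul_nonneg (mul_nonneg hpq.le hn'.le) hq]
  have hQ0 : 0 < γ * s ^ 2 / 2 := by positivity
  have hsL : √(n * p * L) = s * √L := Real.sqrt_mul (by linarith) L
  have hγ' : 400 * entryConst Ck * k * √L ≤ γ * s := by
    rwa [Real.sqrt_div (by linarith), mul_div_assoc', div_le_iff₀ (by positivity)] at hγ
  have hL' : 1 ≤ √L := Real.one_le_sqrt.2 hL
  have hT : 1 ≤ entryConst Ck * √(n * p * L) := by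
    rw [hsL]
    exact one_le_mul_of_one_le_of_one_le hE (one_le_mul_of_one_le_of_one_le hs1 hL')
  have hδ : k * (2 * (entryConst Ck * √(n * p * L)) / ((p - q) * n / 2)) ≤ 1 / 100 := by
    rw [mul_div_assoc', div_le_iff₀ (hQ0.trans_le hQ), hsL]
    have : 400 * entryConst Ck * k * √L * s ≤ γ * s * s := by gcongr
    nlinarith
  obtain ⟨h1, h2⟩ := convolution_pow_of_good hn hne hq hqp hp hk hT hδ hω.1 hω.2.1 hω.2.2 i
  refine ⟨h1, h2.trans ?_⟩
  gcongr ?_ ^ k + _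
  calc (normConst * s + 1) / ((p - q) * n / 2) ≤ (normConst * s + s) / (γ * s ^ 2 / 2) := by
        gcongr
    _ = _ := by field_simp

/-- A product measure on a finite first factor is controlled by a bad set of first coordinates
and uniformly small sections over the others. -/
lemma prod_real_le_of_sections {α β : Type*} [Fintype α] [MeasurableSpace α]
    [MeasurableSingletonClass α] [MeasurableSpace β] (μ : Measure α) (ν : Measure β)
    [IsProbabilityMeasure μ] [IsProbabilityMeasure ν] (G : Set α) (S : α → Set β) {ε : ℝ}
    (h : ∀ a ∈ G, ν.real (S a) ≤ ε) (hε : 0 ≤ ε) :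
    (μ.prod ν).real {x | x.1 ∈ G → x.2 ∈ S x.1} ≤ μ.real Gᶜ + ε := by
  have hsub : {x : α × β | x.1 ∈ G → x.2 ∈ S x.1} ⊆
      Gᶜ ×ˢ Set.univ ∪ ⋃ a, {a} ×ˢ {b | a ∈ G ∧ b ∈ S a} := by
    rintro ⟨a, b⟩ hx
    by_cases ha : a ∈ G
    · exact Or.inr (Set.mem_iUnion.2 ⟨a, rfl, ha, hx ha⟩)
    · exact Or.inl ⟨ha, trivial⟩
  refine (measureReal_mono hsub (by finiteness)).trans ((measureReal_union_le _ _).trans ?_)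
  rw [measureReal_prod_prod, probReal_univ, mul_one]
  gcongr
  refine (measureReal_iUnion_fintype_le _).trans ?_
  calc _ ≤ ∑ a, μ.real {a} * ε := by
        refine Finset.sum_le_sum fun a _ => ?_
        rw [measureReal_prod_prod]
        gcongr
        by_cases ha : a ∈ G
        · simpa [ha] using h a ha
        · simpa [ha] using hε
    _ = ε := by
        rw [← Finset.sum_mul, sum_measureReal_singleton, Finset.coe_univ, probReal_univ, one_mul]

/-- Centered 1-dimensional 2-block CSBM with
`γ ≥ Ω(k√(log n/(np)))`, `p ≥ log³n/n`, `σ ≤ O(1/√(log n))` and `k = O(log n)`: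
with probability `1 - n^{-Ω(1)}`,
`‖(1/η^k) Ã^k x - s‖_∞ ≤ 1/(2√n) + O((C/(γ√(np)))^k σ √(log n))`,
where `x = s + g` and `η = (p-q)n/(2d)`. -/
theorem exact_recovery_one_dim :
    ∀ Ck : ℝ, 0 < Ck →
      ∃ (C₁ C₂ C₃ C c : ℝ) (n₀ : ℕ), 0 < C₁ ∧ 0 < C₂ ∧ 0 < C₃ ∧ 0 < C ∧ 0 < c ∧
        ∀ (n k : ℕ) (p q σ : ℝ),
          n₀ ≤ n → Even n → 0 ≤ q → q < p → p ≤ 1 → 0 < σ →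
          (k : ℝ) ≤ Ck * Real.log n →
          C₁ * k * Real.sqrt (Real.log n / (n * p)) ≤ (p - q) / (p + q) →
          (Real.log n) ^ 3 / n ≤ p →
          σ ≤ C₃ / Real.sqrt (Real.log n) →
          ENNReal.ofReal (1 - (n : ℝ) ^ (-c)) ≤
            ((sbm n p q).prod (gauss1 n σ))
              {ω | ∀ i : Fin n,
                |(((p - q) * n / (2 * avgDeg ω.1)) ^ k)⁻¹ *
                    ((tildeA ω.1 ^ k).mulVec fun j => sig n j + ω.2 j) i - sig n i| ≤
                  1 / (2 * Real.sqrt n) +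
                    C₂ * ((C / (((p - q) / (p + q)) * Real.sqrt (n * p))) ^ k *
                      σ * Real.sqrt (Real.log n))} := by
  intro Ck hCk
  have hev : ∀ᶠ n : ℕ in Filter.atTop, 1 ≤ Real.log n ∧ 3 + 2 * Ck ≤ Real.log n ^ 2 ∧
      2 * Ck + 3 ≤ n ∧ 0 < n := by
    have hlog : Filter.Tendsto (fun n : ℕ => Real.log n) Filter.atTop Filter.atTop :=
      Real.tendsto_log_atTop.comp tendsto_natCast_atTop_atTop
    filter_upwards [hlog.eventually_ge_atTop 1, hlog.eventually_ge_atTop (3 + 2 * Ck),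
      tendsto_natCast_atTop_atTop.eventually_ge_atTop (2 * Ck + 3),
      Filter.eventually_gt_atTop 0] with n h1 h2 h3 h4
    exact ⟨h1, by nlinarith, h3, h4⟩
  obtain ⟨n₀, hn₀⟩ := Filter.eventually_atTop.1 hev
  have hE := one_le_entryConst hCk
  have hN := normConst_pos
  refine ⟨400 * entryConst Ck, 3, 1 / 96, 2 * (normConst + 1), 1, n₀, by positivity,
    by norm_num, by norm_num, by positivity, one_pos, ?_⟩
  intro n k p q σ hn hne hq hqp hp hσ hk hγ hlp hσL
  obtain ⟨hL1, hL2, hn3, hn0⟩ := hn₀ n hn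
  have hn' : (0 : ℝ) < n := by exact_mod_cast hn0
  have hnp3 : Real.log n ^ 3 ≤ n * p := by
    rwa [div_le_iff₀ hn', mul_comm] at hlp
  have hnp1 : 1 ≤ n * p := (one_le_pow₀ hL1).trans hnp3
  have hμ := isProbabilityMeasure_sbm (n := n) hq hqp.le hp
  have hν := isProbabilityMeasure_gauss1 n σ
  set T := entryConst Ck * √(n * p * Real.log n)
  set T' := normConst * √(n * p)
  set P : (Fin n → Fin n → Bool) → Matrix (Fin n) (Fin n) ℝ :=
    fun ω => (((p - q) * n / (2 * avgDeg ω))⁻¹ • tildeA ω) ^ k with hP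
  set R : (Fin n → Fin n → Bool) → Fin n → Set (Fin n → ℝ) := fun ω i =>
    {g | 3 * σ * ‖WithLp.toLp 2 (P ω i)‖ * √(Real.log n) < |∑ l, P ω i l * g l|} with hR
  set W := {ω : (Fin n → Fin n → Bool) × (Fin n → ℝ) | ∀ i : Fin n,
    |(((p - q) * n / (2 * avgDeg ω.1)) ^ k)⁻¹ *
        ((tildeA ω.1 ^ k).mulVec fun j => sig n j + ω.2 j) i - sig n i| ≤
      1 / (2 * Real.sqrt n) +
        3 * ((2 * (normConst + 1) / (((p - q) / (p + q)) * Real.sqrt (n * p))) ^ k *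
          σ * Real.sqrt (Real.log n))} with hW
  have hsub : Wᶜ ⊆ {x | x.1 ∈ {ω | GoodGraph n k p q T T' ω} → x.2 ∈ ⋃ i, R x.1 i} := by
    rintro ⟨ω, g⟩ hx hω
    by_contra hg
    refine hx fun i => ?_
    have hg' : |∑ l, P ω i l * g l| ≤ 3 * σ * ‖WithLp.toLp 2 (P ω i)‖ * √(Real.log n) := by
      by_contra hlt
      exact hg (Set.mem_iUnion.2 ⟨i, not_le.1 hlt⟩)
    obtain ⟨h1, h2⟩ := hω.propagation hCk hn0 hne hq hqp hp hL1 hnp1 hγ i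
    have h := abs_mulVec_sub_sig_le hn0 hL1 hσ hσL i h1 h2 hg'
    rw [smul_pow, inv_pow, smul_mulVec] at h
    simpa only [Pi.smul_apply, smul_eq_mul] using h
  have hsec (ω : Fin n → Fin n → Bool) : (gauss1 n σ).real (⋃ i, R ω i) ≤ 2 / (n : ℝ) ^ 2 := by
    refine (measureReal_iUnion_fintype_le _).trans ?_
    calc _ ≤ ∑ _i : Fin n, 2 * ((n : ℝ) ^ 3)⁻¹ :=
          Finset.sum_le_sum fun i _ => gauss1_real_lt_abs_sum_le hn0 hσ hL1 (P ω i)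
      _ = _ := by
          rw [Finset.sum_const, Finset.card_univ, Fintype.card_fin, nsmul_eq_mul]
          field_simp
  have hbad : ((sbm n p q).prod (gauss1 n σ)).real Wᶜ ≤ (n : ℝ)⁻¹ :=
    calc _ ≤ (2 * Ck + 1) / (n : ℝ) ^ 2 + 2 / (n : ℝ) ^ 2 := by
          refine (measureReal_mono hsub (by finiteness)).trans
            ((prod_real_le_of_sections _ _ _ _ (fun ω _ => hsec ω) (by positivity)).trans ?_)
          gcongr
          exact sbm_real_not_goodGraph_le hCk hn0 hq hqp.le hp hL1 hL2 hk hnp3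
      _ = (2 * Ck + 3) / (n : ℝ) ^ 2 := by ring
      _ ≤ n / (n : ℝ) ^ 2 := by gcongr
      _ = _ := by field_simp
  have huniv : 1 ≤ ((sbm n p q).prod (gauss1 n σ)).real W +
      ((sbm n p q).prod (gauss1 n σ)).real Wᶜ := by
    rw [← probReal_univ (μ := (sbm n p q).prod (gauss1 n σ)), ← Set.union_compl_self W]
    exact measureReal_union_le _ _
  rw [Real.rpow_neg_one]
  refine ENNReal.ofReal_le_of_le_toReal ?_
  change 1 - (n : ℝ)⁻¹ ≤ ((sbm n p q).prod (gauss1 n σ)).real W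
  linarith
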